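/- Let $d\ge 3$ and $p$ a symmetric nearest-neighbor kernel close to simple random walk. There exists $C>0$ such that for all $x\in V_L$ and $z\in\partial V_L$: $C^{-1}\frac{\mathrm{d}_L(x)}{|x-z|^d} \le \pi^{(p)}_L(x,z) \le C\frac{\max\{1,\mathrm{d}_L(x)\}}{|x-z|^d}$, where $\mathrm{d}_L(x)=L-|x|$ is the distance of $x$ to the boundary. -/

import Mathlib

open scoped Classical

noncomputable section

/-- The standard unit vector `e i` in `ℤ^d`. -/
def unitVec {d : ℕ} (i : Fin d) : Fin d → ℤ := fun j => if j = i then 1 else 0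

/-- Euclidean norm of a lattice point. -/
def znorm {d : ℕ} (x : Fin d → ℤ) : ℝ := Real.sqrt (∑ i, ((x i : ℝ))^2)

/-- One step of the symmetric nearest-neighbor walk with kernel `p`. -/
def stepOp {d : ℕ} (p : Fin d → ℝ) (f : (Fin d → ℤ) → ℝ) : (Fin d → ℤ) → ℝ :=
  fun x => ∑ i, p i * (f (x + unitVec i) + f (x - unitVec i))

/-- One step of the walk absorbed on the set `A`. -/
def stopOp {d : ℕ} (p : Fin d → ℝ) (A : Set (Fin d → ℤ)) (f : (Fin d → ℤ) → ℝ) :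
    (Fin d → ℤ) → ℝ :=
  fun x => if x ∈ A then f x else stepOp p f x

/-- `exitProb p L x z`: probability that the `p`-walk started at `x` exits the ball
`V_L = {y : |y| ≤ L}` precisely at `z`. -/
def exitProb {d : ℕ} (p : Fin d → ℝ) (L : ℝ) (x z : Fin d → ℤ) : ℝ :=
  ⨆ n : ℕ, (stopOp p {y | L < znorm y})^[n]
    (fun y => if L < znorm y ∧ y = z then (1:ℝ) else 0) x

/-- The outer boundary `∂V_L` of the discrete ball `V_L`. -/
def outerBoundary (d : ℕ) (L : ℝ) : Set (Fin d → ℤ) :=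
  {z | L < znorm z ∧ ∃ i : Fin d, znorm (z - unitVec i) ≤ L ∨ znorm (z + unitVec i) ≤ L}

theorem tay_half : ∃ C > (0:ℝ), ∀ v : ℝ, |v| ≤ 1/2 →
    |(√(1+v))⁻¹ - (1 - (1/2) * v + (3/8) * v^2)| ≤ C * |v|^3 := by
  refine ⟨20, by norm_num, fun v hv => ?_⟩
  have hv' := abs_le.1 hv
  have h1 : 0 < 1 + v := by linarith
  set t := (√(1+v))⁻¹ with ht
  have htpos : 0 < t := by positivity
  have ht2 : t^2 * (1+v) = 1 := by
    rw [ht, inv_pow, Real.sq_sqrt h1.le]; field_simp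
  set P := 1 - (1/2) * v + (3/8) * v^2 with hP
  have hPpos : 1/2 ≤ P := by nlinarith [sq_nonneg v]
  have hid : (t - P) * ((t + P) * (1+v)) = - v^3 * (5/8 - 15/64 * v + 9/64 * v^2) := by
    have : (t - P) * ((t + P) * (1+v)) = 1 - P^2 * (1+v) := by linear_combination ht2
    rw [this, hP]; ring
  have hq : 1/4 ≤ (t+P)*(1+v) := by nlinarith
  have hb : |5/8 - 15/64 * v + 9/64 * v^2| ≤ 5 := by
    rw [abs_le]; constructor <;> nlinarith
  have h2 : |t - P| * ((t+P)*(1+v)) = |v|^3 * |5/8 - 15/64 * v + 9/64 * v^2| := by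
    rw [← abs_of_pos (show 0 < (t+P)*(1+v) by linarith), ← abs_mul, hid, abs_mul, abs_neg, abs_pow]
  have h3 : |t - P| * (1/4) ≤ |v|^3 * 5 := by
    calc _ ≤ |t - P| * ((t+P)*(1+v)) := by gcongr
      _ ≤ _ := by rw [h2]; gcongr
  linarith

theorem tay (s : ℕ) : ∃ C > (0:ℝ), ∀ v : ℝ, |v| ≤ 1/2 →
    |((√(1+v))⁻¹)^s - (1 - (s/2) * v + (s*(s+2)/8) * v^2)| ≤ C * |v|^3 := by
  induction s with
  | zero => exact ⟨1, one_pos, fun v _ => by simp⟩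
  | succ n ih =>
    obtain ⟨C1, hC1, h1⟩ := tay_half
    obtain ⟨C2, hC2, h2⟩ := ih
    refine ⟨C2 * (2 + C1) + C1 * (1 + n + n*(n+2)) + (3/8*n + n * (n+2) + n*(n+2)), by positivity, fun v hv => ?_⟩
    have h1 := h1 v hv
    have h2 := h2 v hv
    set t := (√(1+v))⁻¹
    have hid : t^(n+1) - (1 - ((n+1:ℕ)/2) * v + ((n+1:ℕ)*((n+1:ℕ)+2)/8) * v^2)
      = (t^n - (1 - (n/2) * v + (n*(n+2)/8) * v^2)) * t
        + (1 - (n/2) * v + (n*(n+2)/8) * v^2) * (t - (1 - (1/2) * v + (3/8) * v^2))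
        + v^3 * (-(3/16)*n - n*(n+2)/16 + 3*n*(n+2)/64 * v) := by
      push_cast; ring
    rw [hid]
    have hv0 := abs_nonneg v
    have hv3 : |v|^3 ≤ 1 := pow_le_one₀ hv0 (by linarith)
    have ht : |t| ≤ 2 + C1 := by
      have e : t = (t - (1 - (1/2) * v + (3/8) * v^2)) + (1 - (1/2) * v + (3/8) * v^2) := by ring
      have : |(1 - (1/2) * v + (3/8) * v^2)| ≤ 2 := by
        rw [abs_le] at hv ⊢; constructor <;> nlinarith
      have h5 : |t| ≤ |t - (1 - (1/2) * v + (3/8) * v^2)| + |(1 - (1/2) * v + (3/8) * v^2)| := by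
        have := abs_add_le (t - (1 - (1/2) * v + (3/8) * v^2)) (1 - (1/2) * v + (3/8) * v^2)
        rwa [← e] at this
      have : C1 * |v|^3 ≤ C1 * 1 := by gcongr
      linarith
    have hn : (0:ℝ) ≤ n := by positivity
    have hnn : (0:ℝ) ≤ (n:ℝ)*(n+2) := by positivity
    have hP : |(1 - ((n:ℝ)/2) * v + ((n:ℝ)*(n+2)/8) * v^2)| ≤ 1 + (n:ℝ) + n*(n+2) := by
      rw [abs_le] at hv ⊢
      have hvv : v^2 ≤ 1 := by nlinarith
      have hw : (n:ℝ)*(n+2) * v^2 ≤ n*(n+2) * 1 := by gcongr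
      have hw' := mul_nonneg hnn (sq_nonneg v)
      constructor <;> nlinarith
    have hE : |(-(3/16)*n - n*(n+2)/16 + 3*n*(n+2)/64 * v)| ≤ 3/8*n + n * (n+2) + n*(n+2) := by
      rw [abs_le] at hv ⊢; constructor <;> nlinarith
    calc _ ≤ _ := abs_add_three _ _ _
      _ = |t^n - (1 - (n/2) * v + (n*(n+2)/8) * v^2)| * |t| + |(1 - (n/2) * v + (n*(n+2)/8) * v^2)| * |t - (1 - (1/2) * v + (3/8) * v^2)| + |v|^3 * |(-(3/16)*n - n*(n+2)/16 + 3*n*(n+2)/64 * v)| := by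
          rw [abs_mul, abs_mul, abs_mul, abs_pow]
      _ ≤ (C2 * |v|^3) * (2 + C1) + (1 + n + n*(n+2)) * (C1 * |v|^3) + |v|^3 * (3/8*n + n * (n+2) + n*(n+2)) := by
          gcongr
      _ = _ := by ring

theorem coordTay (s : ℕ) : ∃ C > (0:ℝ), ∀ ε b η : ℝ, 0 < ε → ε ≤ 1/20 → 0 ≤ b → b ≤ 2 → |η| ≤ 2 →
    |((√(1+(2*b*η*ε+b*ε^2)))⁻¹)^s + ((√(1+(-(2*b*η*ε)+b*ε^2)))⁻¹)^s - 2
      - (-(s*b) + s*(s+2)*b^2*η^2)*ε^2| ≤ C * ε^3 ∧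
    |((√(1+(2*b*η*ε+b*ε^2)))⁻¹)^s - ((√(1+(-(2*b*η*ε)+b*ε^2)))⁻¹)^s
      + 2*s*b*η*ε| ≤ C * ε^3 := by
  obtain ⟨C, hC, h⟩ := tay s
  refine ⟨2000 * C + 8 * (s * (s+2)), by positivity, fun ε b η hε hε' hb hb' hη => ?_⟩
  have habs : |2*b*η*ε| ≤ 8 * ε := by
    rw [abs_mul, abs_mul, abs_mul, abs_of_pos hε, abs_of_nonneg hb, abs_of_pos (two_pos)]
    have : b * |η| ≤ 2 * 2 := by gcongr
    nlinarith
  have hb2 : |b*ε^2| ≤ 2 * ε := by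
    rw [abs_of_nonneg (by positivity)]
    have : b * ε ≤ 2 * 1 := by gcongr; linarith
    nlinarith
  have hv1 : |2*b*η*ε+b*ε^2| ≤ 10 * ε := (abs_add_le _ _).trans (by linarith)
  have hv2 : |-(2*b*η*ε)+b*ε^2| ≤ 10 * ε := (abs_add_le _ _).trans (by rw [abs_neg]; linarith)
  have h1 := h _ (hv1.trans (by linarith))
  have h2 := h _ (hv2.trans (by linarith))
  have h1' : C * |2*b*η*ε+b*ε^2|^3 ≤ C * (10*ε)^3 := by gcongr
  have h2' : C * |-(2*b*η*ε)+b*ε^2|^3 ≤ C * (10*ε)^3 := by gcongr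
  replace h1 := h1.trans h1'
  replace h2 := h2.trans h2'
  set v1 := 2*b*η*ε+b*ε^2 with hv1d
  set v2 := -(2*b*η*ε)+b*ε^2 with hv2d
  set T1 := ((√(1+v1))⁻¹)^s
  set T2 := ((√(1+v2))⁻¹)^s
  have hs : (0:ℝ) ≤ s * (s+2) := by positivity
  have hbb : b^2 ≤ 4 := by nlinarith
  have hη' := abs_le.1 hη
  constructor
  · have e : T1 + T2 - 2 - (-(s*b) + s*(s+2)*b^2*η^2)*ε^2 =
      (T1 - (1 - (s/2) * v1 + (s*(s+2)/8) * v1^2)) + (T2 - (1 - (s/2) * v2 + (s*(s+2)/8) * v2^2))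
        + (s*(s+2)) * (b^2*ε^4/4) := by rw [hv1d, hv2d]; ring
    rw [e]
    have h3 : |(s*(s+2)) * (b^2*ε^4/4)| ≤ 8 * (s*(s+2)) * ε^3 := by
      rw [abs_of_nonneg (by positivity)]
      have : b^2*ε^4/4 ≤ 8 * ε^3 := by
        have : b^2 * ε ≤ 4 * 1 := by gcongr; linarith
        have h5 : 0 < ε^3 := by positivity
        nlinarith
      nlinarith
    refine (abs_add_three _ _ _).trans ?_
    have h6 : C * (10*ε)^3 = 1000 * C * ε^3 := by ring
    have h7 : (2000 * C + 8 * (s * (s+2))) * ε^3 = 2000 * C * ε^3 + 8 * (s*(s+2)) * ε^3 := by ring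
    linarith
  · have e : T1 - T2 + 2*s*b*η*ε =
      (T1 - (1 - (s/2) * v1 + (s*(s+2)/8) * v1^2)) - (T2 - (1 - (s/2) * v2 + (s*(s+2)/8) * v2^2))
        + (s*(s+2)) * (b^2*η*ε^3) := by rw [hv1d, hv2d]; ring
    rw [e]
    have h3 : |(s*(s+2)) * (b^2*η*ε^3)| ≤ 8 * (s*(s+2)) * ε^3 := by
      rw [abs_mul, abs_of_nonneg hs, abs_mul, abs_mul, abs_of_nonneg (sq_nonneg b), abs_of_nonneg (by positivity : 0 ≤ ε^3)]
      have : b^2 * |η| * ε^3 ≤ (4 * 2) * ε^3 := by gcongr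
      nlinarith
    have h4 := abs_add_le ((T1 - (1 - (s/2) * v1 + (s*(s+2)/8) * v1^2)) - (T2 - (1 - (s/2) * v2 + (s*(s+2)/8) * v2^2))) ((s*(s+2)) * (b^2*η*ε^3))
    have h5 := abs_sub (T1 - (1 - (s/2) * v1 + (s*(s+2)/8) * v1^2)) (T2 - (1 - (s/2) * v2 + (s*(s+2)/8) * v2^2))
    have h6 : C * (10*ε)^3 = 1000 * C * ε^3 := by ring
    have h7 : (2000 * C + 8 * (s * (s+2))) * ε^3 = 2000 * C * ε^3 + 8 * (s*(s+2)) * ε^3 := by ring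
    linarith

/-- coordinate version, first power of `φ` -/
theorem coordOne (s : ℕ) : ∃ C > (0:ℝ), ∀ ε b η R φ x : ℝ, 0 < ε → ε ≤ 1/20 → 0 ≤ b → b ≤ 2 → |η| ≤ 2 →
    1 ≤ R → |φ| * ε ≤ 6 * R → |x| ≤ 2 * R →
    |(φ - 2*x - 1) * ((√(1+(2*b*η*ε+b*ε^2)))⁻¹)^s
      + (φ + 2*x - 1) * ((√(1+(-(2*b*η*ε)+b*ε^2)))⁻¹)^s - 2 * φ
      - (φ * (-(s*b) + s*(s+2)*b^2*η^2)*ε^2 + 4*s*b*η*ε*x - 2)| ≤ C * R * ε^2 := by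
  obtain ⟨C, hC, h⟩ := coordTay s
  refine ⟨11 * C + 2 * s + 16 * (s * (s+2)), by positivity, fun ε b η R φ x hε hε' hb hb' hη hR hφ hx => ?_⟩
  obtain ⟨h1, h2⟩ := h ε b η hε hε' hb hb' hη
  set T1 := ((√(1+(2*b*η*ε+b*ε^2)))⁻¹)^s
  set T2 := ((√(1+(-(2*b*η*ε)+b*ε^2)))⁻¹)^s
  set A := (-(s*b) + s*(s+2)*b^2*η^2) with hA
  have hAb : |A| ≤ 2 * s + 16 * (s * (s+2)) := by
    have hη2 : η^2 ≤ 4 := by rw [← sq_abs]; nlinarith [abs_nonneg η]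
    have hbb : b^2 ≤ 4 := by nlinarith
    have h0 : b^2 * η^2 ≤ 4 * 4 := by gcongr
    have hs : (0:ℝ) ≤ s * (s+2) := by positivity
    have hs1 : (0:ℝ) ≤ s := by positivity
    have : 0 ≤ b^2 * η^2 := by positivity
    rw [hA, abs_le]; constructor <;> nlinarith
  have e : (φ - 2*x - 1) * T1 + (φ + 2*x - 1) * T2 - 2 * φ - (φ * A*ε^2 + 4*s*b*η*ε*x - 2)
    = (φ - 1) * (T1 + T2 - 2 - A * ε^2) - 2 * x * (T1 - T2 + 2*s*b*η*ε) - A * ε^2 := by ring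
  rw [e]
  have g1 : |(φ - 1) * (T1 + T2 - 2 - A * ε^2)| ≤ 7 * C * R * ε^2 := by
    rw [abs_mul]
    have : |φ - 1| * ε ≤ 7 * R := by
      have := abs_sub φ 1
      rw [abs_one] at this
      nlinarith
    calc _ ≤ |φ - 1| * (C * ε^3) := by gcongr
      _ = (|φ - 1| * ε) * (C * ε^2) := by ring
      _ ≤ (7 * R) * (C * ε^2) := by gcongr
      _ = _ := by ring
  have g2 : |2 * x * (T1 - T2 + 2*s*b*η*ε)| ≤ 4 * C * R * ε^2 := by
    rw [abs_mul, abs_mul, abs_of_pos (two_pos)]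
    calc _ ≤ 2 * (2 * R) * (C * ε^3) := by gcongr
      _ = 4 * C * R * ε^2 * ε := by ring
      _ ≤ 4 * C * R * ε^2 * 1 := by gcongr; linarith
      _ = _ := by ring
  have g3 : |A * ε^2| ≤ (2 * s + 16 * (s * (s+2))) * R * ε^2 := by
    rw [abs_mul, abs_of_nonneg (sq_nonneg ε)]
    have : |A| ≤ (2 * s + 16 * (s * (s+2))) * R := hAb.trans (le_mul_of_one_le_right (by positivity) hR)
    gcongr
  have k1 := abs_sub ((φ - 1) * (T1 + T2 - 2 - A * ε^2) - 2 * x * (T1 - T2 + 2*s*b*η*ε)) (A * ε^2)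
  have k2 := abs_sub ((φ - 1) * (T1 + T2 - 2 - A * ε^2)) (2 * x * (T1 - T2 + 2*s*b*η*ε))
  linarith

set_option maxHeartbeats 1000000 in
theorem coordTwo (s : ℕ) : ∃ C > (0:ℝ), ∀ ε b η R φ x : ℝ, 0 < ε → ε ≤ 1/20 → 0 ≤ b → b ≤ 2 → |η| ≤ 2 →
    1 ≤ R → |φ| * ε ≤ 6 * R → |x| ≤ 2 * R → 1 ≤ 6 * R * ε →
    8 * x^2 - C * (R * |φ| * ε + R^2 * ε) ≤ (φ - 2*x - 1)^2 * ((√(1+(2*b*η*ε+b*ε^2)))⁻¹)^s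
      + (φ + 2*x - 1)^2 * ((√(1+(-(2*b*η*ε)+b*ε^2)))⁻¹)^s - 2 * φ^2 := by
  obtain ⟨C, hC, h⟩ := coordTay s
  set D := 2 * s + 16 * (s * (s+2)) + C with hD
  have hD0 : 0 < D := by positivity
  refine ⟨18 * D + 24 + 64 * (s + C), by positivity, fun ε b η R φ x hε hε' hb hb' hη hR hφ hx hRε => ?_⟩
  obtain ⟨h1, h2⟩ := h ε b η hε hε' hb hb' hη
  set T1 := ((√(1+(2*b*η*ε+b*ε^2)))⁻¹)^s
  set T2 := ((√(1+(-(2*b*η*ε)+b*ε^2)))⁻¹)^s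
  set A := (-(s*b) + s*(s+2)*b^2*η^2) with hA
  have hAb : |A| ≤ 2 * s + 16 * (s * (s+2)) := by
    have hη2 : η^2 ≤ 4 := by rw [← sq_abs]; nlinarith [abs_nonneg η]
    have hbb : b^2 ≤ 4 := by nlinarith
    have h0 : b^2 * η^2 ≤ 4 * 4 := by gcongr
    have hs : (0:ℝ) ≤ s * (s+2) := by positivity
    have hs1 : (0:ℝ) ≤ s := by positivity
    have : 0 ≤ b^2 * η^2 := by positivity
    rw [hA, abs_le]; constructor <;> nlinarith
  have hS : |T1 + T2 - 2| ≤ D * ε^2 := by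
    have k := abs_add_le (T1 + T2 - 2 - A * ε^2) (A * ε^2)
    have k2 : |A * ε^2| ≤ (2 * s + 16 * (s * (s+2))) * ε^2 := by
      rw [abs_mul, abs_of_nonneg (sq_nonneg ε)]; gcongr
    have k3 : C * ε^3 ≤ C * ε^2 := by
      have : ε^3 ≤ ε^2 := pow_le_pow_of_le_one hε.le (by linarith) (by norm_num)
      gcongr
    rw [sub_add_cancel] at k
    rw [hD]; linarith
  have hDd : |T1 - T2| ≤ (8 * s + C) * ε := by
    have k := abs_sub (T1 - T2 + 2*s*b*η*ε) (2*s*b*η*ε)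
    have k2 : |2*s*b*η*ε| ≤ 8 * s * ε := by
      rw [abs_mul, abs_mul, abs_mul, abs_mul, abs_of_pos hε, abs_of_nonneg hb, abs_of_pos (two_pos), Nat.abs_cast]
      calc (2:ℝ) * s * b * |η| * ε ≤ 2 * s * 2 * 2 * ε := by gcongr
        _ = _ := by ring
    have k3 : C * ε^3 ≤ C * ε := by
      have : ε^3 ≤ ε := by nlinarith [mul_pos hε hε]
      gcongr
    rw [add_sub_cancel_right] at k
    linarith
  have e : (φ - 2*x - 1)^2 * T1 + (φ + 2*x - 1)^2 * T2 - 2 * φ^2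
    = 8 * x^2 + ((φ-1)^2 + 4 * x^2) * (T1 + T2 - 2) - 4 * φ + 2 - 4 * (φ - 1) * x * (T1 - T2) := by ring
  rw [e]
  set F := |φ| with hF
  have hF0 : 0 ≤ F := abs_nonneg _
  have hφ2 : φ^2 = F^2 := (sq_abs φ).symm
  have hx2 : x^2 ≤ 4 * R^2 := by rw [← sq_abs]; nlinarith [abs_nonneg x]
  have hFm : (φ-1)^2 ≤ 2 * F^2 + 2 := by rw [← hφ2]; nlinarith [sq_nonneg (φ+1)]
  have g1 : |((φ-1)^2 + 4 * x^2) * (T1 + T2 - 2)| ≤ 18 * D * (R * F * ε + R^2 * ε) := by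
    rw [abs_mul, abs_of_nonneg (by positivity : 0 ≤ (φ-1)^2 + 4 * x^2)]
    have g0 : (φ-1)^2 + 4 * x^2 ≤ 2 * F^2 + 18 * R^2 := by nlinarith
    calc _ ≤ (2 * F^2 + 18 * R^2) * (D * ε^2) := by gcongr
      _ = D * (2 * F * ε * (F * ε) + 18 * R^2 * ε * ε) := by ring
      _ ≤ D * (2 * F * ε * (6 * R) + 18 * R^2 * ε * 1) := by gcongr; linarith
      _ ≤ _ := by
        have : 0 ≤ D * (R * F * ε) := by positivity
        linarith
  have g2 : 4 * F ≤ 24 * (R * F * ε) := by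
    calc 4 * F = 4 * F * 1 := by ring
      _ ≤ 4 * F * (6 * R * ε) := by gcongr
      _ = _ := by ring
  have g2' : -(4 * φ) ≥ - (4 * F) := by linarith [le_abs_self φ]
  have g3 : |4 * (φ - 1) * x * (T1 - T2)| ≤ 64 * (s + C) * (R * F * ε + R^2 * ε) := by
    have : |φ - 1| ≤ F + R := by
      have := abs_sub φ 1
      rw [abs_one] at this
      linarith
    rw [abs_mul, abs_mul, abs_mul, abs_of_pos (four_pos)]
    calc _ ≤ 4 * (F + R) * (2 * R) * ((8 * s + C) * ε) := by gcongr
      _ = (64 * s + 8 * C) * (R * F * ε + R^2 * ε) := by ring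
      _ ≤ _ := by gcongr; linarith
  have := abs_le.1 g1
  have := abs_le.1 g3
  have g4 : 0 ≤ R^2 * ε := by positivity
  have g5 : (18 * D + 24 + 64 * (s + C)) * (R * F * ε + R^2 * ε) = 18 * D * (R * F * ε + R^2 * ε)
    + 24 * (R * F * ε) + 24 * (R^2 * ε) + 64 * (s + C) * (R * F * ε + R^2 * ε) := by ring
  rw [g5]
  linarith

def phiF {d : ℕ} (R : ℝ) (x : Fin d → ℤ) : ℝ := R^2 - ∑ i, (x i : ℝ)^2

def qF {d : ℕ} (p : Fin d → ℝ) (w : Fin d → ℝ) (x : Fin d → ℤ) : ℝ :=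
  ∑ i, ((x i : ℝ) - w i)^2 / (2 * d * p i)

def eF {d : ℕ} (p : Fin d → ℝ) (w : Fin d → ℝ) (x : Fin d → ℤ) : ℝ := (√(qF p w x))⁻¹

def nF {d : ℕ} (w : Fin d → ℝ) (x : Fin d → ℤ) : ℝ := ∑ i, ((x i : ℝ) - w i)^2

theorem sum_shift {d : ℕ} (f : Fin d → ℝ → ℝ) (x : Fin d → ℤ) (i : Fin d) (c : ℤ) :
    ∑ j, f j ((x + c • unitVec i) j : ℤ) = (∑ j, f j (x j)) + (f i (x i + c) - f i (x i)) := by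
  rw [← Finset.add_sum_erase _ _ (Finset.mem_univ i), ← Finset.add_sum_erase _ (fun j => f j (x j)) (Finset.mem_univ i)]
  have : ∑ j ∈ Finset.univ.erase i, f j ((x + c • unitVec i) j : ℤ) = ∑ j ∈ Finset.univ.erase i, f j (x j) := by
    apply Finset.sum_congr rfl
    intro j hj
    have : j ≠ i := Finset.ne_of_mem_erase hj
    simp [unitVec, this]
  rw [this]
  simp [unitVec]
  ring

theorem phiF_add {d : ℕ} (R : ℝ) (x : Fin d → ℤ) (i : Fin d) :
    phiF R (x + unitVec i) = phiF R x - 2 * x i - 1 := by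
  have := sum_shift (fun _ t => t^2) x i 1
  rw [one_smul] at this
  unfold phiF; rw [this]; push_cast; ring

theorem phiF_sub {d : ℕ} (R : ℝ) (x : Fin d → ℤ) (i : Fin d) :
    phiF R (x - unitVec i) = phiF R x + 2 * x i - 1 := by
  have := sum_shift (fun _ t => t^2) x i (-1)
  rw [neg_smul, one_smul, ← sub_eq_add_neg] at this
  unfold phiF; rw [this]; push_cast; ring

theorem qF_add {d : ℕ} (p w) (x : Fin d → ℤ) (i : Fin d) :
    qF p w (x + unitVec i) = qF p w x + (2 * (x i - w i) + 1) / (2 * d * p i) := by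
  have := sum_shift (fun j t => (t - w j)^2 / (2 * d * p j)) x i 1
  rw [one_smul] at this
  unfold qF; rw [this]; push_cast; ring

theorem qF_sub {d : ℕ} (p w) (x : Fin d → ℤ) (i : Fin d) :
    qF p w (x - unitVec i) = qF p w x + (-(2 * (x i - w i)) + 1) / (2 * d * p i) := by
  have := sum_shift (fun j t => (t - w j)^2 / (2 * d * p j)) x i (-1)
  rw [neg_smul, one_smul, ← sub_eq_add_neg] at this
  unfold qF; rw [this]; push_cast; ring

structure Geo {d : ℕ} (p : Fin d → ℝ) (R : ℝ) (w : Fin d → ℝ) (x : Fin d → ℤ) : Prop where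
  hd : 0 < d
  plo : ∀ i, 1 / (4 * (d:ℝ)) ≤ p i
  phi : ∀ i, p i ≤ 1 / d
  psum : ∑ i, 2 * p i = 1
  hR : 1 ≤ R
  hw : ∑ i, (w i)^2 = R^2
  hq : 0 < qF p w x
  he : eF p w x ≤ 1/20
  hphi : |phiF R x| * eF p w x ≤ 6 * R
  hx : ∀ i, |(x i : ℝ)| ≤ 2 * R
  hRe : 1 ≤ 6 * R * eF p w x

namespace Geo
variable {d : ℕ} {p : Fin d → ℝ} {R : ℝ} {w : Fin d → ℝ} {x : Fin d → ℤ}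

theorem ppos (h : Geo p R w x) (i : Fin d) : 0 < p i := by
  have : (0:ℝ) < d := by exact_mod_cast h.hd
  exact lt_of_lt_of_le (by positivity) (h.plo i)

theorem epos (h : Geo p R w x) : 0 < eF p w x := by
  have := h.hq
  unfold eF; positivity

theorem esq (h : Geo p R w x) : qF p w x * eF p w x ^ 2 = 1 := by
  have := h.hq
  unfold eF; rw [inv_pow, Real.sq_sqrt this.le]; field_simp

theorem b_le (h : Geo p R w x) (i : Fin d) : 1 / (2 * d * p i) ≤ 2 := by
  have hd : (0:ℝ) < d := by exact_mod_cast h.hd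
  have := h.ppos i
  have h1 := h.plo i
  rw [div_le_iff₀ (by positivity)] at h1 ⊢
  linarith

theorem eta_le (h : Geo p R w x) (i : Fin d) : |((x i : ℝ) - w i) * eF p w x| ≤ 2 := by
  have hd : (0:ℝ) < d := by exact_mod_cast h.hd
  have hp := h.ppos i
  have h1 : ((x i : ℝ) - w i)^2 / (2 * d * p i) ≤ qF p w x :=
    Finset.single_le_sum (f := fun i => ((x i : ℝ) - w i)^2 / (2 * d * p i))
      (fun j _ => by have := h.ppos j; positivity) (Finset.mem_univ i)
  have h2 : 2 * d * p i ≤ 4 := by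
    have h1 := h.phi i
    rw [le_div_iff₀ (by positivity)] at h1
    linarith
  rw [div_le_iff₀ (by positivity)] at h1
  have h3 := h.esq
  have hq := h.hq
  apply abs_le_of_sq_le_sq _ (by norm_num)
  rw [mul_pow]
  calc _ ≤ (qF p w x * (2 * d * p i)) * eF p w x ^2 := by gcongr
    _ = (2 * d * p i) * (qF p w x * eF p w x ^ 2) := by ring
    _ ≤ _ := by rw [h3]; linarith

theorem eF_add (h : Geo p R w x) (i : Fin d) : eF p w (x + unitVec i) = eF p w x *
    (√(1 + (2 * (1 / (2 * d * p i)) * (((x i : ℝ) - w i) * eF p w x) * eF p w x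
      + (1 / (2 * d * p i)) * eF p w x ^ 2)))⁻¹ := by
  have h3 := h.esq
  have hq := h.hq
  have : qF p w (x + unitVec i) = qF p w x * (1 + (2 * (1 / (2 * d * p i)) * (((x i : ℝ) - w i) * eF p w x) * eF p w x
      + (1 / (2 * d * p i)) * eF p w x ^ 2)) := by
    rw [qF_add]
    linear_combination (-(2 * (x i - w i) + 1) * (1 / (2 * d * p i))) * h3
  rw [eF, this, Real.sqrt_mul hq.le, mul_inv]; rfl

theorem eF_sub (h : Geo p R w x) (i : Fin d) : eF p w (x - unitVec i) = eF p w x *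
    (√(1 + (-(2 * (1 / (2 * d * p i)) * (((x i : ℝ) - w i) * eF p w x) * eF p w x)
      + (1 / (2 * d * p i)) * eF p w x ^ 2)))⁻¹ := by
  have h3 := h.esq
  have hq := h.hq
  have : qF p w (x - unitVec i) = qF p w x * (1 + (-(2 * (1 / (2 * d * p i)) * (((x i : ℝ) - w i) * eF p w x) * eF p w x)
      + (1 / (2 * d * p i)) * eF p w x ^ 2)) := by
    rw [qF_sub]
    linear_combination (-(-(2 * (x i - w i)) + 1) * (1 / (2 * d * p i))) * h3
  rw [eF, this, Real.sqrt_mul hq.le, mul_inv]; rfl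

theorem dot (h : Geo p R w x) : ∑ i, (x i : ℝ) * (x i - w i) = (nF w x - phiF R x) / 2 := by
  have hw := h.hw
  unfold nF phiF
  rw [← hw, ← Finset.sum_sub_distrib, ← Finset.sum_sub_distrib, Finset.sum_div]
  apply Finset.sum_congr rfl
  intro i _
  ring

end Geo

theorem stepOne (d s : ℕ) : ∃ C > (0:ℝ), ∀ (p : Fin d → ℝ) (R : ℝ) (w : Fin d → ℝ) (x : Fin d → ℤ),
    Geo p R w x →
    |stepOp p (fun x => phiF R x * eF p w x ^ s) x - phiF R x * eF p w x ^ s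
      - eF p w x ^ (s+2) / (2 * d) * (s * (s - d) * phiF R x + 2 * s * nF w x - 2 * d * qF p w x)|
      ≤ C * R * eF p w x ^ (s+2) := by
  obtain ⟨C, hC, h⟩ := coordOne s
  refine ⟨C, hC, fun p R w x g => ?_⟩
  have hd : (0:ℝ) < d := by exact_mod_cast g.hd
  have hds : ∀ i, p i * (1 / (2 * d * p i)) = 1 / (2 * d) := fun i => by
    have := g.ppos i
    field_simp
  have hc := fun i => h (eF p w x) (1 / (2 * d * p i)) (((x i : ℝ) - w i) * eF p w x) R (phiF R x) (x i) g.epos g.he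
    (by have := g.ppos i; positivity) (g.b_le i) (g.eta_le i) g.hR g.hphi (g.hx i)
  set E := eF p w x with hE
  set φ := phiF R x with hφ
  set b : Fin d → ℝ := fun i => 1 / (2 * d * p i) with hb
  set y : Fin d → ℝ := fun i => (x i : ℝ) - w i with hy
  have hsum : stepOp p (fun x => phiF R x * eF p w x ^ s) x - φ * E ^ s
      = E^s * ∑ i, p i * ((φ - 2*x i - 1) * ((√(1+(2*b i*(y i * E)*E+b i*E^2)))⁻¹)^s
      + (φ + 2*x i - 1) * ((√(1+(-(2*b i*(y i * E)*E)+b i*E^2)))⁻¹)^s - 2 * φ) := by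
    have : φ * E^s = ∑ i, E^s * (p i * (2 * φ)) := by
      have : ∑ i, E^s * (p i * (2 * φ)) = (∑ i, 2 * p i) * (E^s * φ) := by
        rw [Finset.sum_mul]; exact Finset.sum_congr rfl (fun i _ => by ring)
      rw [this, g.psum]; ring
    rw [this, stepOp, ← Finset.sum_sub_distrib, Finset.mul_sum]
    apply Finset.sum_congr rfl
    intro i _
    rw [phiF_add, phiF_sub, g.eF_add, g.eF_sub, mul_pow, mul_pow]
    ring
  have hmain : E ^ (s+2) / (2 * d) * (s * (s - d) * φ + 2 * s * nF w x - 2 * d * qF p w x)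
      = E^s * ∑ i, p i * (φ * (-(s*b i) + s*(s+2)*(b i)^2*(y i * E)^2)*E^2 + 4*s*b i*(y i * E)*E*x i - 2) := by
    have e1 : ∀ i, p i * (φ * (-(s*b i) + s*(s+2)*(b i)^2*(y i * E)^2)*E^2 + 4*s*b i*(y i * E)*E*x i - 2)
        = - (φ * s * E^2 / (2 * d)) + φ * s * (s+2) * E^4 / (2 * d) * ((x i - w i)^2/ (2 * d * p i))
          + 4 * s * E^2 / (2 * d) * (x i * (x i - w i)) - 2 * p i := by
      intro i
      have k1 : p i * b i = 1 / (2 * d) := hds i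
      have k2 : (x i - w i)^2/ (2 * d * p i) = (y i)^2 * b i := by simp only [hb, hy]; ring
      rw [k2]
      have k3 : (x i : ℝ) - w i = y i := rfl
      rw [k3]
      linear_combination (-(φ * s * E^2) + φ * s * (s+2) * b i * y i^2 * E^4 + 4 * s * y i * E^2 * x i) * k1
    simp_rw [e1]
    rw [Finset.sum_sub_distrib, Finset.sum_add_distrib, Finset.sum_add_distrib, g.psum, ← Finset.mul_sum, ← Finset.mul_sum,
      g.dot, Finset.sum_const, Finset.card_univ, Fintype.card_fin, nsmul_eq_mul]
    have h5 : ∑ i, ((x i : ℝ) - w i)^2/ (2 * d * p i) = qF p w x := rfl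
    rw [h5]
    have h6 : qF p w x * E^2 = 1 := g.esq
    rw [← hφ]
    have h7 : φ * s * (s+2) * E^4 / (2 * d) * qF p w x = φ * s * (s+2) * E^2 / (2 * d) := by
      linear_combination φ * s * (s+2) * E^2 / (2 * d) * h6
    have h8 : E ^ (s+2) / (2 * d) * (s * (s - d) * φ + 2 * s * nF w x - 2 * d * qF p w x)
      = E ^ (s+2) / (2 * d) * (s * (s - d) * φ + 2 * s * nF w x) - E^s := by
      have : E ^ (s+2) / (2 * d) * (2 * d * qF p w x) = E^s := by
        field_simp
        rw [pow_add, mul_assoc, mul_comm (E^2), h6, mul_one]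
      rw [mul_sub, this]
    rw [h7, h8]
    field_simp
    ring
  rw [hsum, hmain, ← mul_sub, ← Finset.sum_sub_distrib, abs_mul, abs_of_nonneg (pow_nonneg g.epos.le s)]
  have hE0 : 0 < E := g.epos
  have : |∑ i, (p i * ((φ - 2*x i - 1) * ((√(1+(2*b i*(y i * E)*E+b i*E^2)))⁻¹)^s
      + (φ + 2*x i - 1) * ((√(1+(-(2*b i*(y i * E)*E)+b i*E^2)))⁻¹)^s - 2 * φ) -
      p i * (φ * (-(s*b i) + s*(s+2)*(b i)^2*(y i * E)^2)*E^2 + 4*s*b i*(y i * E)*E*x i - 2))| ≤ C * R * E^2 := by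
    refine (Finset.abs_sum_le_sum_abs _ _).trans ?_
    calc _ ≤ ∑ i, (2 * p i) * (C * R * E^2) := by
          apply Finset.sum_le_sum
          intro i _
          have := g.ppos i
          have hR := g.hR
          rw [← mul_sub, abs_mul, abs_of_pos this]
          have h9 : 0 ≤ C * R * E^2 := by positivity
          calc _ ≤ p i * (C * R * E^2) := mul_le_mul_of_nonneg_left (hc i) this.le
            _ ≤ _ := by gcongr; linarith
      _ = _ := by rw [← Finset.sum_mul, g.psum, one_mul]
  calc _ ≤ E^s * (C * R * E^2) := by gcongr
    _ = _ := by rw [pow_add]; ring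

theorem stepTwo (d s : ℕ) : ∃ C > (0:ℝ), ∀ (p : Fin d → ℝ) (R : ℝ) (w : Fin d → ℝ) (x : Fin d → ℤ),
    Geo p R w x →
    eF p w x ^ s * (2 / d * (∑ i, (x i : ℝ)^2) - C * (R * |phiF R x| * eF p w x + R^2 * eF p w x))
    ≤ stepOp p (fun x => phiF R x ^ 2 * eF p w x ^ s) x - phiF R x ^ 2 * eF p w x ^ s := by
  obtain ⟨C, hC, h⟩ := coordTwo s
  refine ⟨C, hC, fun p R w x g => ?_⟩
  have hd : (0:ℝ) < d := by exact_mod_cast g.hd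
  have hc := fun i => h (eF p w x) (1 / (2 * d * p i)) (((x i : ℝ) - w i) * eF p w x) R (phiF R x) (x i) g.epos g.he
    (by have := g.ppos i; positivity) (g.b_le i) (g.eta_le i) g.hR g.hphi (g.hx i) g.hRe
  set E := eF p w x with hE
  set φ := phiF R x with hφ
  set b : Fin d → ℝ := fun i => 1 / (2 * d * p i) with hb
  set y : Fin d → ℝ := fun i => (x i : ℝ) - w i with hy
  have hsum : stepOp p (fun x => phiF R x ^ 2 * eF p w x ^ s) x - φ^2 * E ^ s
      = E^s * ∑ i, p i * ((φ - 2*x i - 1)^2 * ((√(1+(2*b i*(y i * E)*E+b i*E^2)))⁻¹)^s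
      + (φ + 2*x i - 1)^2 * ((√(1+(-(2*b i*(y i * E)*E)+b i*E^2)))⁻¹)^s - 2 * φ^2) := by
    have : φ^2 * E^s = ∑ i, E^s * (p i * (2 * φ^2)) := by
      have : ∑ i, E^s * (p i * (2 * φ^2)) = (∑ i, 2 * p i) * (E^s * φ^2) := by
        rw [Finset.sum_mul]; exact Finset.sum_congr rfl (fun i _ => by ring)
      rw [this, g.psum]; ring
    rw [this, stepOp, ← Finset.sum_sub_distrib, Finset.mul_sum]
    apply Finset.sum_congr rfl
    intro i _
    rw [phiF_add, phiF_sub, g.eF_add, g.eF_sub, mul_pow, mul_pow]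
    ring
  have hE0 : 0 < E := g.epos
  have hR := g.hR
  rw [hsum]
  gcongr
  set X := C * (R * |φ| * E + R^2 * E) with hX
  have hX0 : 0 ≤ X := by positivity
  calc 2 / d * (∑ i, (x i : ℝ)^2) - X = ∑ i, (2 / d * (x i : ℝ)^2 - (2 * p i) * X) := by
        rw [Finset.sum_sub_distrib, ← Finset.mul_sum, ← Finset.sum_mul, g.psum, one_mul]
    _ ≤ _ := by
        apply Finset.sum_le_sum
        intro i _
        have hp := g.ppos i
        have hpl := g.plo i
        refine le_trans ?_ (mul_le_mul_of_nonneg_left (hc i) hp.le)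
        have : (1 / (4 * (d:ℝ))) * (8 * (x i:ℝ)^2) ≤ p i * (8 * (x i:ℝ)^2) := by gcongr
        have e : (1 / (4 * (d:ℝ))) * (8 * (x i:ℝ)^2) = 2 / d * (x i : ℝ)^2 := by field_simp; ring
        nlinarith [mul_nonneg hp.le hX0]

theorem stepOp_add {d : ℕ} (p : Fin d → ℝ) (f g : (Fin d → ℤ) → ℝ) (x) :
    stepOp p (fun x => f x + g x) x = stepOp p f x + stepOp p g x := by
  unfold stepOp; rw [← Finset.sum_add_distrib]; exact Finset.sum_congr rfl (fun i _ => by ring)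

theorem stepOp_sub {d : ℕ} (p : Fin d → ℝ) (f g : (Fin d → ℤ) → ℝ) (x) :
    stepOp p (fun x => f x - g x) x = stepOp p f x - stepOp p g x := by
  unfold stepOp; rw [← Finset.sum_sub_distrib]; exact Finset.sum_congr rfl (fun i _ => by ring)

theorem stepOp_mul {d : ℕ} (p : Fin d → ℝ) (c : ℝ) (g : (Fin d → ℤ) → ℝ) (x) :
    stepOp p (fun x => c * g x) x = c * stepOp p g x := by
  unfold stepOp; rw [Finset.mul_sum]; exact Finset.sum_congr rfl (fun i _ => by ring)

theorem n_sub_q {d : ℕ} {p : Fin d → ℝ} {R : ℝ} {w : Fin d → ℝ} {x : Fin d → ℤ} (g : Geo p R w x)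
    {κ : ℝ} (hκ : ∀ i, |p i - 1 / (2 * (d:ℝ))| ≤ κ) :
    |nF w x - qF p w x| ≤ 2 * d * κ * qF p w x := by
  have hd : (0:ℝ) < d := by exact_mod_cast g.hd
  unfold nF qF
  rw [← Finset.sum_sub_distrib, Finset.mul_sum]
  refine (Finset.abs_sum_le_sum_abs _ _).trans (Finset.sum_le_sum fun i _ => ?_)
  have hp := g.ppos i
  have : ((x i:ℝ) - w i)^2 - ((x i:ℝ) - w i)^2 / (2 * d * p i)
      = 2 * d * (p i - 1 / (2 * d)) * (((x i:ℝ) - w i)^2 / (2 * d * p i)) := by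
    field_simp
  rw [this, abs_mul, abs_mul, abs_of_pos (by positivity : (0:ℝ) < 2 * d),
    abs_of_nonneg (by positivity : 0 ≤ ((x i:ℝ) - w i)^2 / (2 * d * p i))]
  have := hκ i
  gcongr

/-- lower bound for the second power with positive `φ` -/
theorem stepTwo' (d s : ℕ) (hd3 : 3 ≤ d) : ∃ C > (0:ℝ), ∃ e0 > (0:ℝ), ∀ (p : Fin d → ℝ) (R : ℝ) (w : Fin d → ℝ) (x : Fin d → ℤ),
    Geo p R w x → eF p w x ≤ e0 → 0 ≤ phiF R x →
    eF p w x ^ s * (R^2 / d - C * (R * phiF R x * eF p w x))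
    ≤ stepOp p (fun x => phiF R x ^ 2 * eF p w x ^ s) x - phiF R x ^ 2 * eF p w x ^ s := by
  obtain ⟨C, hC, h⟩ := stepTwo d s
  have hd : (3:ℝ) ≤ d := by exact_mod_cast hd3
  refine ⟨C + 6, by positivity, 1 / (d * C), by positivity, fun p R w x g he hφ => le_trans ?_ (h p R w x g)⟩
  have hE := g.epos
  have hR := g.hR
  have hRe := g.hRe
  have hφd : ∑ i, (x i : ℝ)^2 = R^2 - phiF R x := by unfold phiF; ring
  rw [abs_of_nonneg hφ, hφd]
  set E := eF p w x
  set φ := phiF R x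
  refine mul_le_mul_of_nonneg_left ?_ (by positivity)
  have h1 : C * (R^2 * E) ≤ R^2 / d := by
    calc _ ≤ C * (R^2 * (1 / (d * C))) := by gcongr
      _ = _ := by field_simp
  have h2 : 2 / d * φ ≤ 6 * (R * φ * E) := by
    have : 2 / (d:ℝ) ≤ 1 := by rw [div_le_one (by linarith)]; linarith
    calc _ ≤ 1 * φ := by gcongr
      _ ≤ (6 * R * E) * φ := by gcongr
      _ = _ := by ring
  have h3 : 2 / d * (R^2 - φ) = R^2 / d + R^2 / d - 2 / d * φ := by ring
  rw [h3]
  linarith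

set_option maxHeartbeats 1000000 in
theorem barrier (d : ℕ) (hd3 : 3 ≤ d) : ∃ κ > (0:ℝ), ∃ e0 > (0:ℝ),
    ∃ W : (Fin d → ℝ) → ℝ → (Fin d → ℝ) → (Fin d → ℤ) → ℝ,
    ∀ (p : Fin d → ℝ) (R : ℝ) (w : Fin d → ℝ) (x : Fin d → ℤ),
    Geo p R w x → (∀ i, |p i - 1 / (2 * (d:ℝ))| ≤ κ) → eF p w x ≤ e0 →
    |W p R w x| ≤ 1/2 * (|phiF R x| * eF p w x ^ d) ∧
    (0 ≤ phiF R x → |stepOp p (fun x => phiF R x * eF p w x ^ d) x - phiF R x * eF p w x ^ d|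
      ≤ stepOp p (W p R w) x - W p R w x) := by
  have hd : (3:ℝ) ≤ d := by exact_mod_cast hd3
  obtain ⟨C1, hC1, h1⟩ := stepOne d d
  obtain ⟨C2, hC2, h2⟩ := stepOne d (d+1)
  obtain ⟨C4, hC4, h4⟩ := stepOne d (d-1)
  obtain ⟨C3, hC3, e3, he3, h3⟩ := stepTwo' d (d+2) hd3
  obtain ⟨C5, hC5, e5, he5, h5⟩ := stepTwo' d d hd3
  obtain ⟨m, hm, hmC⟩ : ∃ m > (0:ℝ), 6 * (4 * m * C5) + 36 * m ≤ 1/4 := by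
    refine ⟨1 / (4 * (24 * C5 + 36)), by positivity, le_of_eq ?_⟩
    field_simp; ring
  obtain ⟨B, hB, hBC⟩ : ∃ B > (0:ℝ), B / (2 * d) = C1 :=
    ⟨2 * d * C1, by positivity, by field_simp⟩
  set Kp := 2 * B * C3 with hKp
  set M := 4 * m * C5 with hM
  have hKp0 : 0 < Kp := by positivity
  have hM0 : 0 < M := by positivity
  set κ : ℝ := min (m / (4 * (d:ℝ)^2)) (1 / (2 * (d:ℝ) * ((d:ℝ)+1))) with hκd
  have hκ0 : 0 < κ := by rw [hκd]; positivity
  have hκ1 : 2 * (d:ℝ) * κ ≤ m / (2 * (d:ℝ)) := by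
    have : κ ≤ m / (4 * (d:ℝ)^2) := min_le_left _ _
    calc _ ≤ 2 * (d:ℝ) * (m / (4 * (d:ℝ)^2)) := by gcongr
      _ = _ := by field_simp; ring
  have hκ2 : 2 * (d:ℝ) * κ * ((d:ℝ)+1) ≤ 1 := by
    have : κ ≤ 1 / (2 * (d:ℝ) * ((d:ℝ)+1)) := min_le_right _ _
    calc _ ≤ 2 * (d:ℝ) * (1 / (2 * (d:ℝ) * ((d:ℝ)+1))) * ((d:ℝ)+1) := by gcongr
      _ = _ := by field_simp
  set e0 := min (min e3 e5) (min (min (B / (2 * d) / (Kp * C2)) (m / (2*d) / (M * C4))) (1/4 / (Kp + 6 * B))) with he0d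
  have he0 : 0 < e0 := by rw [he0d]; positivity
  refine ⟨κ, hκ0, e0, he0, fun p R w x => Kp * (phiF R x * eF p w x ^ (d+1)) + B / R * (phiF R x ^ 2 * eF p w x ^ (d+2))
    + (-(M / R)) * (phiF R x * eF p w x ^ (d-1)) + m / R^2 * (phiF R x ^ 2 * eF p w x ^ d), fun p R w x g hκ he => ?_⟩
  have hN := abs_le.1 (n_sub_q g hκ)
  have hE3 : eF p w x ≤ e3 := he.trans ((min_le_left _ _).trans (min_le_left _ _))
  have hE5 : eF p w x ≤ e5 := he.trans ((min_le_left _ _).trans (min_le_right _ _))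
  have hEa : eF p w x ≤ B / (2 * d) / (Kp * C2) := he.trans ((min_le_right _ _).trans ((min_le_left _ _).trans (min_le_left _ _)))
  have hEb : eF p w x ≤ m / (2 * d) / (M * C4) := he.trans ((min_le_right _ _).trans ((min_le_left _ _).trans (min_le_right _ _)))
  have hEc : eF p w x ≤ 1/4 / (Kp + 6 * B) := he.trans ((min_le_right _ _).trans (min_le_right _ _))
  rw [le_div_iff₀ (by positivity)] at hEa hEb hEc
  have hE := g.epos
  have hR := g.hR
  have hR0 : 0 < R := by linarith
  have hRe := g.hRe
  have hq := g.hq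
  have hqE := g.esq
  have hφE := g.hphi
  have hpd : eF p w x ^ d = eF p w x ^ (d-1) * eF p w x := by
    rw [← pow_succ]; congr 1; omega
  specialize h1 p R w x g
  specialize h2 p R w x g
  specialize h4 p R w x g
  specialize h3 p R w x g hE3
  specialize h5 p R w x g hE5
  constructor
  · clear h1 h2 h3 h4 h5
    beta_reduce
    set E := eF p w x
    set φ := phiF R x
    set P := E^(d-1)
    have hP : 0 < P := by positivity
    have e1 : Kp * (φ * E^(d+1)) + B / R * (φ ^ 2 * E^(d+2)) + (-(M / R)) * (φ * P) + m / R^2 * (φ ^ 2 * E^d)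
      = φ * E^d * (Kp * E + B * (φ * E / R) * E + (-(M / (R * E))) + m * (φ * E / R) / (R * E)) := by
      rw [pow_add, pow_add, hpd]
      field_simp
    rw [e1, abs_mul, abs_mul, abs_of_pos (by positivity : 0 < E^d), mul_comm (1/2 : ℝ)]
    gcongr
    have hf : |φ * E / R| ≤ 6 := by
      rw [abs_div, abs_mul, abs_of_pos hE, abs_of_pos hR0, div_le_iff₀ hR0]; exact hφE
    have hi : 1 / (R * E) ≤ 6 := by rw [div_le_iff₀ (by positivity)]; linarith
    set f := φ * E / R
    have hi0 : 0 < 1 / (R * E) := by positivity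
    have e2 : Kp * E + B * f * E + (-(M / (R * E))) + m * f / (R * E) =
      Kp * E + B * f * E + (-(M * (1 / (R * E)))) + m * f * (1 / (R * E)) := by ring
    rw [e2]
    set r := 1 / (R * E)
    have a1 : |B * f * E| ≤ 6 * B * E := by
      rw [abs_mul, abs_mul, abs_of_pos hB, abs_of_pos hE]
      calc _ ≤ B * 6 * E := by gcongr
        _ = _ := by ring
    have a2 : |m * f * r| ≤ 36 * m := by
      rw [abs_mul, abs_mul, abs_of_pos hm, abs_of_pos hi0]
      calc _ ≤ m * 6 * 6 := by gcongr
        _ = _ := by ring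
    have a3 : M * r ≤ M * 6 := by gcongr
    have a4 : 0 < M * r := by positivity
    have a5 : 0 < Kp * E := by positivity
    have a1 := abs_le.1 a1
    have a2 := abs_le.1 a2
    rw [abs_le]
    constructor <;> nlinarith
  · intro hφ
    specialize h3 hφ
    specialize h5 hφ
    rw [stepOp_add, stepOp_add, stepOp_add, stepOp_mul, stepOp_mul, stepOp_mul, stepOp_mul]
    have hd1 : ((d - 1 : ℕ) : ℝ) = d - 1 := by rw [Nat.cast_sub (by omega)]; simp
    have hd2 : d - 1 + 2 = d + 1 := by omega
    rw [hd1, hd2] at h4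
    push_cast at h2
    set E := eF p w x
    set φ := phiF R x
    set N := nF w x
    set q := qF p w x
    set S1 := stepOp p (fun x => phiF R x * eF p w x ^ d) x - φ * E ^ d
    set S2 := stepOp p (fun x => phiF R x * eF p w x ^ (d+1)) x - φ * E ^ (d+1)
    set S3 := stepOp p (fun x => phiF R x ^ 2 * eF p w x ^ (d+2)) x - φ^2 * E ^ (d+2)
    set S4 := stepOp p (fun x => phiF R x * eF p w x ^ (d-1)) x - φ * E ^ (d-1)
    set S5 := stepOp p (fun x => phiF R x ^ 2 * eF p w x ^ d) x - φ^2 * E ^ d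
    have hgoal : |S1| ≤ Kp * S2 + B / R * S3 + (-(M/R)) * S4 + m / R^2 * S5 → 
      |S1| ≤ Kp * stepOp p (fun x => phiF R x * eF p w x ^ (d+1)) x + B / R * stepOp p (fun x => phiF R x ^ 2 * eF p w x ^ (d+2)) x
       + (-(M / R)) * stepOp p (fun x => phiF R x * eF p w x ^ (d-1)) x + m / R^2 * stepOp p (fun x => phiF R x ^ 2 * eF p w x ^ d) x
       - (Kp * (φ * E ^ (d+1)) + B / R * (φ ^ 2 * E ^ (d+2)) + (-(M / R)) * (φ * E ^ (d-1)) + m / R^2 * (φ ^ 2 * E ^ d)) := by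
      intro h
      refine h.trans (le_of_eq ?_)
      simp only [S2, S3, S4, S5]
      ring
    apply hgoal
    clear hgoal
    clear_value S1 S2 S3 S4 S5
    set Q := E^d with hQ
    have hQ0 : 0 < Q := by positivity
    have p1 : E^(d+1) = Q * E := by rw [pow_add, pow_one]
    have p2 : E^(d+2) = Q * E^2 := by rw [pow_add]
    have p3 : E^(d+1+2) = Q * E^3 := by rw [add_assoc, pow_add]
    rw [p2] at h1 h3
    rw [p3] at h2
    rw [p1] at h4
    -- S1
    have k1 : |S1| ≤ 2 * d * κ * Q + C1 * R * (Q * E^2) := by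
      have e : Q * E^2 / (2 * d) * (d * (d - d) * φ + 2 * d * N - 2 * d * q) = Q * E^2 * (N - q) := by
        field_simp; ring
      rw [e] at h1
      have e2 : |Q * E^2 * (N - q)| ≤ 2 * d * κ * Q := by
        rw [abs_mul, abs_of_pos (by positivity : 0 < Q * E^2)]
        calc _ ≤ Q * E^2 * (2 * d * κ * q) := by gcongr; exact abs_le.2 hN
          _ = 2 * d * κ * Q * (q * E^2) := by ring
          _ = _ := by rw [hqE, mul_one]
      have := abs_add_le (S1 - Q * E^2 * (N - q)) (Q * E^2 * (N - q))
      rw [sub_add_cancel] at this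
      linarith
    have k2 : 1/2 * φ * (Q * E^3) - C2 * R * (Q * E^3) ≤ S2 := by
      have e : φ * d ≤ (d + 1) * (d + 1 - d) * φ + 2 * (d + 1) * N - 2 * d * q := by
        have : 2 * (d+1) * ((1 - 2 * d * κ) * q) ≤ 2 * (d+1) * N := by gcongr; linarith
        have : 2 * d * κ * (d+1) * q ≤ 1 * q := by gcongr
        nlinarith
      have e' : 1/2 * φ * (Q * E^3) ≤ Q * E^3 / (2 * d) * ((d + 1) * (d + 1 - d) * φ + 2 * (d + 1) * N - 2 * d * q) := by
        calc 1/2 * φ * (Q * E^3) = Q * E^3 / (2 * d) * (φ * d) := by field_simp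
          _ ≤ _ := by gcongr
      have := abs_le.1 h2
      linarith
    have k4 : S4 ≤ -(1/4 * φ * (Q * E)) + C4 * R * (Q * E) := by
      have e : (d - 1) * (d - 1 - d) * φ + 2 * (d - 1) * N - 2 * d * q ≤ - (φ * (d / 2)) := by
        have : 2 * (d-1) * N ≤ 2 * (d-1) * ((1 + 2 * d * κ) * q) := by
          have : (0:ℝ) ≤ d - 1 := by linarith
          gcongr; linarith
        have : 2 * d * κ * (d+1) * q ≤ 1 * q := by gcongr
        have : 0 ≤ 2 * d * κ * q := by positivity
        nlinarith
      have e' : Q * E / (2 * d) * ((d - 1) * (d - 1 - d) * φ + 2 * (d - 1) * N - 2 * d * q) ≤ -(1/4 * φ * (Q * E)) := by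
        calc _ ≤ Q * E / (2 * d) * (- (φ * (d / 2))) := by gcongr
          _ = _ := by field_simp; ring
      have := abs_le.1 h4
      linarith
    have m2 : Kp * (1/2 * φ * (Q * E^3) - C2 * R * (Q * E^3)) ≤ Kp * S2 := by gcongr
    have m3 : B / R * (Q * E^2 * (R^2 / d - C3 * (R * φ * E))) ≤ B / R * S3 := by gcongr
    have m4 : M / R * S4 ≤ M / R * (-(1/4 * φ * (Q * E)) + C4 * R * (Q * E)) := by gcongr
    have m5 : m / R^2 * (Q * (R^2 / d - C5 * (R * φ * E))) ≤ m / R^2 * S5 := by gcongr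
    have m3' : B / R * (Q * E^2 * (R^2 / d - C3 * (R * φ * E))) = 2 * (B / (2 * d)) * R * (Q * E^2) - B * C3 * φ * (Q * E^3) := by
      field_simp
    have m4' : M / R * (-(1/4 * φ * (Q * E)) + C4 * R * (Q * E)) = - (m * C5 / R * φ * (Q * E)) + M * C4 * (Q * E) := by
      rw [hM]; field_simp
    have m5' : m / R^2 * (Q * (R^2 / d - C5 * (R * φ * E))) = 2 * (m / (2 * d)) * Q - m * C5 / R * φ * (Q * E) := by
      field_simp
    have m2' : Kp * (1/2 * φ * (Q * E^3) - C2 * R * (Q * E^3)) = B * C3 * φ * (Q * E^3) - (E * (Kp * C2)) * R * (Q * E^2) := by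
      rw [hKp]; ring
    have n2 : (E * (Kp * C2)) * R * (Q * E^2) ≤ B / (2 * d) * R * (Q * E^2) := by gcongr
    have n4 : (E * (M * C4)) * Q ≤ m / (2 * d) * Q := by gcongr
    have n1 : 2 * d * κ * Q ≤ m / (2 * d) * Q := by gcongr
    have n3 : C1 * R * (Q * E^2) = B / (2 * d) * R * (Q * E^2) := by rw [hBC]
    rw [m2'] at m2
    rw [m3'] at m3
    rw [m4'] at m4
    rw [m5'] at m5
    have n5 : M * C4 * (Q * E) = (E * (M * C4)) * Q := by ring
    rw [n5] at m4
    have n6 : (-(M/R)) * S4 = - (M / R * S4) := by ring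
    rw [n6]
    linarith

theorem stepOp_mono {d : ℕ} {p : Fin d → ℝ} (hp : ∀ i, 0 ≤ p i) {f g : (Fin d → ℤ) → ℝ}
    (h : ∀ x, f x ≤ g x) (x) : stepOp p f x ≤ stepOp p g x := by
  unfold stepOp
  refine Finset.sum_le_sum fun i _ => mul_le_mul_of_nonneg_left ?_ (hp i)
  exact add_le_add (h _) (h _)

theorem stopOp_mono {d : ℕ} {p : Fin d → ℝ} (hp : ∀ i, 0 ≤ p i) (A : Set (Fin d → ℤ)) {f g : (Fin d → ℤ) → ℝ}
    (h : ∀ x, f x ≤ g x) (x) : stopOp p A f x ≤ stopOp p A g x := by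
  unfold stopOp
  split_ifs
  · exact h x
  · exact stepOp_mono hp h x

theorem stepOp_const {d : ℕ} {p : Fin d → ℝ} (hs : ∑ i, 2 * p i = 1) (c : ℝ) (x) :
    stepOp p (fun _ => c) x = c := by
  unfold stepOp
  have : ∀ i, p i * (c + c) = (2 * p i) * c := fun i => by ring
  simp only [this]
  rw [← Finset.sum_mul, hs, one_mul]

theorem exitProb_spec {d : ℕ} {p : Fin d → ℝ} (hp : ∀ i, 0 ≤ p i) (hs : ∑ i, 2 * p i = 1)
    (L : ℝ) (z : Fin d → ℤ) :
    (∀ x, 0 ≤ exitProb p L x z) ∧ (∀ x, exitProb p L x z ≤ 1) ∧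
    (∀ x, L < znorm x → exitProb p L x z = if x = z then 1 else 0) ∧
    (∀ x, znorm x ≤ L → exitProb p L x z = stepOp p (fun y => exitProb p L y z) x) := by
  set A : Set (Fin d → ℤ) := {y | L < znorm y} with hA
  set u0 : (Fin d → ℤ) → ℝ := fun y => if L < znorm y ∧ y = z then (1:ℝ) else 0 with hu0
  set u : ℕ → (Fin d → ℤ) → ℝ := fun n => (stopOp p A)^[n] u0 with hu
  have hsucc : ∀ n, u (n+1) = stopOp p A (u n) := fun n => by
    simp only [hu, Function.iterate_succ_apply']
  have hz0 : u 0 = u0 := rfl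
  have h00 : ∀ x, 0 ≤ u0 x := fun x => by simp only [hu0]; split_ifs <;> norm_num
  have h01 : ∀ x, u0 x ≤ 1 := fun x => by simp only [hu0]; split_ifs <;> norm_num
  have hb1 : ∀ n x, u n x ≤ 1 := by
    intro n
    induction n with
    | zero => exact h01
    | succ n ih =>
      intro x
      rw [hsucc]
      refine (stopOp_mono hp A (g := fun _ => 1) ih x).trans ?_
      unfold stopOp
      split_ifs
      · exact le_rfl
      · exact (stepOp_const hs 1 x).le
  have hmono1 : ∀ n x, u n x ≤ u (n+1) x := by
    intro n
    induction n with
    | zero =>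
      intro x
      rw [hsucc, hz0]
      unfold stopOp
      split_ifs with hx
      · exact le_rfl
      · have h1 : u0 x = 0 := by
          simp only [hu0]; rw [if_neg]; rintro ⟨h, _⟩; exact hx h
        rw [h1]
        refine (stepOp_const hs 0 x).symm.le.trans (stepOp_mono hp h00 x)
    | succ n ih =>
      intro x
      rw [hsucc (n+1), hsucc n]
      exact stopOp_mono hp A (by rw [← hsucc]; exact ih) x
  have hmono : ∀ x, Monotone (fun n => u n x) := fun x => monotone_nat_of_le_succ (fun n => hmono1 n x)
  have hbdd : ∀ x, BddAbove (Set.range fun n => u n x) := fun x => ⟨1, by rintro _ ⟨n, rfl⟩; exact hb1 n x⟩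
  have hdef : ∀ x, exitProb p L x z = ⨆ n, u n x := fun x => rfl
  have hlim : ∀ x, Filter.Tendsto (fun n => u n x) Filter.atTop (nhds (exitProb p L x z)) := fun x => by
    rw [hdef]; exact tendsto_atTop_ciSup (hmono x) (hbdd x)
  refine ⟨fun x => (h00 x).trans (le_ciSup (hbdd x) 0), fun x => ciSup_le (fun n => hb1 n x), ?_, ?_⟩
  · intro x hx
    have : ∀ n, u n x = if x = z then 1 else 0 := by
      intro n
      induction n with
      | zero => rw [hz0]; simp only [hu0, hx, true_and]
      | succ n ih => rw [hsucc]; unfold stopOp; rw [if_pos (show x ∈ A from hx)]; exact ih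
    rw [hdef]
    simp only [this]
    exact ciSup_const
  · intro x hx
    have h1 : Filter.Tendsto (fun n => u (n+1) x) Filter.atTop (nhds (exitProb p L x z)) :=
      (hlim x).comp (Filter.tendsto_add_atTop_nat 1)
    have h2 : Filter.Tendsto (fun n => u (n+1) x) Filter.atTop
        (nhds (stepOp p (fun y => exitProb p L y z) x)) := by
      have : (fun n => u (n+1) x) = fun n => stepOp p (u n) x := by
        funext n
        rw [hsucc]; unfold stopOp; rw [if_neg]; exact not_lt.2 hx
      rw [this]
      unfold stepOp
      exact tendsto_finsetSum _ fun i _ => ((hlim _).add (hlim _)).const_mul _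
    exact tendsto_nhds_unique h1 h2

theorem max_principle {d : ℕ} (hd : 0 < d) {p : Fin d → ℝ} (hp : ∀ i, 0 < p i) (hs : ∑ i, 2 * p i = 1)
    (D : Set (Fin d → ℤ)) (hD : D.Finite) (u : (Fin d → ℤ) → ℝ)
    (hsub : ∀ x ∈ D, u x ≤ stepOp p u x)
    (hbd : ∀ x ∈ D, ∀ i, (x + unitVec i ∉ D → u (x + unitVec i) ≤ 0) ∧ (x - unitVec i ∉ D → u (x - unitVec i) ≤ 0)) :
    ∀ x ∈ D, u x ≤ 0 := by
  by_contra! hcon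
  obtain ⟨x0, hx0, hpos0⟩ := hcon
  obtain ⟨xm, hxm, hmax⟩ := Set.exists_max_image D u hD ⟨x0, hx0⟩
  set m := u xm with hm
  have hmpos : 0 < m := hpos0.trans_le (hmax x0 hx0)
  let i0 : Fin d := ⟨0, hd⟩
  set S : Set (Fin d → ℤ) := {x | x ∈ D ∧ u x = m} with hS
  have hSf : S.Finite := hD.subset (fun x hx => hx.1)
  obtain ⟨y, hy, hymax⟩ := Set.exists_max_image S (fun x => x i0) hSf ⟨xm, hxm, rfl⟩
  have hle : ∀ i, u (y + unitVec i) ≤ m ∧ u (y - unitVec i) ≤ m := by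
    intro i
    constructor
    · by_cases h : y + unitVec i ∈ D
      · exact hmax _ h
      · exact ((hbd y hy.1 i).1 h).trans hmpos.le
    · by_cases h : y - unitVec i ∈ D
      · exact hmax _ h
      · exact ((hbd y hy.1 i).2 h).trans hmpos.le
  have hlt : u (y + unitVec i0) < m := by
    refine lt_of_le_of_ne (hle i0).1 fun heq => ?_
    have hin : y + unitVec i0 ∈ D := by
      by_contra h
      have := (hbd y hy.1 i0).1 h
      linarith
    have := hymax _ ⟨hin, heq⟩
    simp [unitVec] at this
  have h1 := hsub y hy.1
  rw [hy.2] at h1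
  have h2 : stepOp p u y < stepOp p (fun _ => m) y := by
    unfold stepOp
    refine Finset.sum_lt_sum (fun i _ => ?_) ⟨i0, Finset.mem_univ _, ?_⟩
    · exact mul_le_mul_of_nonneg_left (add_le_add (hle i).1 (hle i).2) (hp i).le
    · exact mul_lt_mul_of_pos_left (add_lt_add_of_lt_of_le hlt (hle i0).2) (hp i0)
  rw [stepOp_const hs] at h2
  linarith

theorem abs_le_znorm {d : ℕ} (x : Fin d → ℤ) (i) : |(x i : ℝ)| ≤ znorm x := by
  unfold znorm
  apply Real.abs_le_sqrt
  exact Finset.single_le_sum (f := fun i => (x i : ℝ)^2) (fun i _ => sq_nonneg _) (Finset.mem_univ i)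

theorem ball_finite {d : ℕ} (L : ℝ) : {x : Fin d → ℤ | znorm x ≤ L}.Finite := by
  refine Set.Finite.subset (Set.finite_Icc (fun _ => -⌈L⌉) (fun _ : Fin d => ⌈L⌉)) fun x hx => ?_
  have h : ∀ i, |(x i:ℝ)| ≤ ⌈L⌉ := fun i => (abs_le_znorm x i).trans (le_trans hx (Int.le_ceil L))
  constructor <;> intro i
  · have := (abs_le.1 (h i)).1; exact_mod_cast this
  · have := (abs_le.1 (h i)).2; exact_mod_cast this

theorem znorm_nonneg {d : ℕ} (x : Fin d → ℤ) : 0 ≤ znorm x := Real.sqrt_nonneg _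

theorem znorm_mono {d : ℕ} {x y : Fin d → ℤ} (h : ∀ i, |x i| ≤ |y i|) : znorm x ≤ znorm y := by
  unfold znorm
  refine Real.sqrt_le_sqrt (Finset.sum_le_sum fun i _ => ?_)
  have := sq_le_sq.2 (h i)
  exact_mod_cast this

theorem path_lemma {d : ℕ} {p : Fin d → ℝ} (hp : ∀ i, 0 ≤ p i) {q : ℝ} (hq0 : 0 ≤ q) (hq1 : q ≤ 1) (hq : ∀ i, q ≤ p i)
    (L : ℝ) (f : (Fin d → ℤ) → ℝ) (hf0 : ∀ x, 0 ≤ f x) (hf : ∀ x, znorm x ≤ L → f x = stepOp p f x) :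
    ∀ (n : ℕ) (y w : Fin d → ℤ), znorm y ≤ L → znorm w ≤ L → ∑ i, (y i - w i).natAbs ≤ n → q^n * f w ≤ f y := by
  have hstep : ∀ x, znorm x ≤ L → ∀ i, q * f (x + unitVec i) ≤ f x ∧ q * f (x - unitVec i) ≤ f x := by
    intro x hx i
    have h1 : p i * (f (x + unitVec i) + f (x - unitVec i)) ≤ f x := by
      rw [hf x hx]; unfold stepOp
      exact Finset.single_le_sum (f := fun i => p i * (f (x + unitVec i) + f (x - unitVec i)))
        (fun i _ => mul_nonneg (hp i) (add_nonneg (hf0 _) (hf0 _))) (Finset.mem_univ i)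
    have a := hf0 (x + unitVec i)
    have b := hf0 (x - unitVec i)
    have c := hq i
    constructor <;> nlinarith
  intro n
  induction n with
  | zero =>
    intro y w _ _ h
    have : y = w := by
      funext i
      have := Finset.sum_eq_zero_iff.1 (Nat.le_zero.1 h) i (Finset.mem_univ i)
      omega
    rw [this]; simp
  | succ n ih =>
    intro y w hy hw h
    by_cases heq : y = w
    · subst heq
      have : q^(n+1) ≤ 1 := pow_le_one₀ hq0 hq1
      nlinarith [hf0 y]
    have hdec : ∀ (y' w' : Fin d → ℤ) (i : Fin d), (∀ j, (y' j - w' j).natAbs ≤ (y j - w j).natAbs) →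
        (y' i - w' i).natAbs < (y i - w i).natAbs → ∑ j, (y' j - w' j).natAbs ≤ n := by
      intro y' w' i h1 h2
      have := Finset.sum_lt_sum (fun j (_ : j ∈ Finset.univ) => h1 j) ⟨i, Finset.mem_univ i, h2⟩
      omega
    have hu : ∀ i j : Fin d, unitVec i j = if j = i then 1 else 0 := fun _ _ => rfl
    by_cases hA : ∃ i, w i < y i ∧ 0 < y i
    · obtain ⟨i, h1, h2⟩ := hA
      have hn : znorm (y - unitVec i) ≤ L := by
        refine (znorm_mono fun j => ?_).trans hy
        rw [Pi.sub_apply, hu]; split_ifs with hj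
        · subst hj; rw [abs_of_pos h2, abs_of_nonneg (by omega)]; omega
        · simp
      have := ih (y - unitVec i) w hn hw (hdec _ _ i (fun j => by
        rw [Pi.sub_apply, hu]; split_ifs with hj
        · subst hj; omega
        · simp) (by rw [Pi.sub_apply, hu, if_pos rfl]; omega))
      calc q^(n+1) * f w = q * (q^n * f w) := by ring
        _ ≤ q * f (y - unitVec i) := by gcongr
        _ ≤ _ := (hstep y hy i).2
    by_cases hB : ∃ i, y i < w i ∧ y i < 0
    · obtain ⟨i, h1, h2⟩ := hB
      have hn : znorm (y + unitVec i) ≤ L := by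
        refine (znorm_mono fun j => ?_).trans hy
        rw [Pi.add_apply, hu]; split_ifs with hj
        · subst hj; rw [abs_of_neg h2, abs_of_nonpos (by omega)]; omega
        · simp
      have := ih (y + unitVec i) w hn hw (hdec _ _ i (fun j => by
        rw [Pi.add_apply, hu]; split_ifs with hj
        · subst hj; omega
        · simp) (by rw [Pi.add_apply, hu, if_pos rfl]; omega))
      calc q^(n+1) * f w = q * (q^n * f w) := by ring
        _ ≤ q * f (y + unitVec i) := by gcongr
        _ ≤ _ := (hstep y hy i).1
    push Not at hA hB
    obtain ⟨i, hi⟩ : ∃ i, y i ≠ w i := by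
      by_contra! hc; exact heq (funext hc)
    rcases lt_or_gt_of_ne hi with h1 | h1
    · have h2 := hB i h1
      have hn : znorm (w - unitVec i) ≤ L := by
        refine (znorm_mono fun j => ?_).trans hw
        rw [Pi.sub_apply, hu]; split_ifs with hj
        · subst hj; rw [abs_of_nonneg (by omega), abs_of_nonneg (by omega)]; omega
        · simp
      have := ih y (w - unitVec i) hy hn (hdec _ _ i (fun j => by
        rw [Pi.sub_apply, hu]; split_ifs with hj
        · subst hj; omega
        · simp) (by rw [Pi.sub_apply, hu, if_pos rfl]; omega))
      have h3 := (hstep _ hn i).1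
      rw [sub_add_cancel] at h3
      calc q^(n+1) * f w = q^n * (q * f w) := by ring
        _ ≤ q^n * f (w - unitVec i) := by gcongr
        _ ≤ _ := this
    · have h2 := hA i h1
      have hn : znorm (w + unitVec i) ≤ L := by
        refine (znorm_mono fun j => ?_).trans hw
        rw [Pi.add_apply, hu]; split_ifs with hj
        · subst hj; rw [abs_of_nonpos (by omega), abs_of_nonpos (by omega)]; omega
        · simp
      have := ih y (w + unitVec i) hy hn (hdec _ _ i (fun j => by
        rw [Pi.add_apply, hu]; split_ifs with hj
        · subst hj; omega
        · simp) (by rw [Pi.add_apply, hu, if_pos rfl]; omega))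
      have h3 := (hstep _ hn i).2
      rw [add_sub_cancel_right] at h3
      calc q^(n+1) * f w = q^n * (q * f w) := by ring
        _ ≤ q^n * f (w + unitVec i) := by gcongr
        _ ≤ _ := this

/-- Euclidean norm of a real vector. -/
def vnorm {d : ℕ} (v : Fin d → ℝ) : ℝ := Real.sqrt (∑ i, (v i)^2)

theorem vnorm_eq {d : ℕ} (v : Fin d → ℝ) : vnorm v = ‖WithLp.toLp 2 v‖ := by
  rw [EuclideanSpace.norm_eq]; unfold vnorm; simp

theorem vnorm_nonneg {d : ℕ} (v : Fin d → ℝ) : 0 ≤ vnorm v := Real.sqrt_nonneg _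

theorem vnorm_sq {d : ℕ} (v : Fin d → ℝ) : vnorm v ^ 2 = ∑ i, (v i)^2 :=
  Real.sq_sqrt (Finset.sum_nonneg fun i _ => sq_nonneg _)

theorem vnorm_tri {d : ℕ} (a b c : Fin d → ℝ) : vnorm (a - c) ≤ vnorm (a - b) + vnorm (b - c) := by
  simp only [vnorm_eq, WithLp.toLp_sub]
  exact norm_sub_le_norm_sub_add_norm_sub _ _ _

theorem vnorm_comm {d : ℕ} (a b : Fin d → ℝ) : vnorm (a - b) = vnorm (b - a) := by
  simp only [vnorm_eq, WithLp.toLp_sub]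
  exact norm_sub_rev _ _

theorem vnorm_abs {d : ℕ} (a b : Fin d → ℝ) : |vnorm a - vnorm b| ≤ vnorm (a - b) := by
  simp only [vnorm_eq, WithLp.toLp_sub]
  exact abs_norm_sub_norm_le _ _

theorem vnorm_sub_le {d : ℕ} (a b : Fin d → ℝ) : vnorm (a - b) ≤ vnorm a + vnorm b := by
  simp only [vnorm_eq, WithLp.toLp_sub]
  exact norm_sub_le _ _

theorem vnorm_smul {d : ℕ} (c : ℝ) (a : Fin d → ℝ) : vnorm (c • a) = |c| * vnorm a := by
  simp only [vnorm_eq, WithLp.toLp_smul, norm_smul, Real.norm_eq_abs]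

/-- coercion of lattice points -/
def cv {d : ℕ} (x : Fin d → ℤ) : Fin d → ℝ := fun i => x i

theorem znorm_eq {d : ℕ} (x : Fin d → ℤ) : znorm x = vnorm (cv x) := rfl

theorem cv_sub {d : ℕ} (x y : Fin d → ℤ) : cv (x - y) = cv x - cv y := by
  funext i; simp [cv]

theorem cv_add {d : ℕ} (x y : Fin d → ℤ) : cv (x + y) = cv x + cv y := by
  funext i; simp [cv]

theorem vnorm_unit {d : ℕ} (i : Fin d) : vnorm (cv (unitVec i)) = 1 := by
  unfold vnorm cv unitVec
  simp

theorem nbr_add {d : ℕ} (x : Fin d → ℤ) (i : Fin d) (w : Fin d → ℝ) :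
    |vnorm (cv (x + unitVec i) - w) - vnorm (cv x - w)| ≤ 1 := by
  refine (vnorm_abs _ _).trans (le_of_eq ?_)
  rw [← vnorm_unit i, cv_add]; congr 1; abel

theorem nbr_sub {d : ℕ} (x : Fin d → ℤ) (i : Fin d) (w : Fin d → ℝ) :
    |vnorm (cv (x - unitVec i) - w) - vnorm (cv x - w)| ≤ 1 := by
  refine (vnorm_abs _ _).trans (le_of_eq ?_)
  rw [vnorm_comm, ← vnorm_unit i, cv_sub]; congr 1; abel

theorem phiF_eq {d : ℕ} (R : ℝ) (x : Fin d → ℤ) : phiF R x = R^2 - znorm x ^ 2 := by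
  rw [znorm_eq, vnorm_sq]; rfl

/-- The geometric lemma. -/
theorem geoLemma {d : ℕ} (hd : 0 < d) {p : Fin d → ℝ} (plo : ∀ i, 1 / (4 * (d:ℝ)) ≤ p i)
    (phi : ∀ i, p i ≤ 1 / d) (psum : ∑ i, 2 * p i = 1) {R : ℝ} (hR : 1 ≤ R) {w : Fin d → ℝ}
    (hw : vnorm w = R) {x : Fin d → ℤ} (hx : znorm x ≤ R + 1) (hr : 40 ≤ vnorm (cv x - w)) :
    Geo p R w x ∧ 1 / (2 * vnorm (cv x - w)) ≤ eF p w x ∧ eF p w x ≤ 2 / vnorm (cv x - w) := by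
  have hd' : (0:ℝ) < d := by exact_mod_cast hd
  set r := vnorm (cv x - w) with hrd
  have hr2 : r^2 = ∑ i, ((x i:ℝ) - w i)^2 := by rw [hrd, vnorm_sq]; rfl
  have hq1 : qF p w x ≤ 2 * r^2 := by
    rw [hr2, Finset.mul_sum]; unfold qF
    refine Finset.sum_le_sum fun i _ => ?_
    have h1 := plo i
    have h0 : 0 < p i := lt_of_lt_of_le (by positivity) h1
    rw [div_le_iff₀ (by positivity)] at h1 ⊢
    nlinarith [sq_nonneg ((x i:ℝ) - w i)]
  have hq2 : r^2 ≤ 2 * qF p w x := by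
    unfold qF; rw [hr2, Finset.mul_sum]
    refine Finset.sum_le_sum fun i _ => ?_
    have h1 := plo i
    have h0 : 0 < p i := lt_of_lt_of_le (by positivity) h1
    have h2 := phi i
    rw [le_div_iff₀ (by positivity)] at h2
    rw [← mul_div_assoc, le_div_iff₀ (by positivity)]
    nlinarith [sq_nonneg ((x i:ℝ) - w i)]
  have hq : 0 < qF p w x := by nlinarith
  have hs1 : √(qF p w x) ≤ 2 * r := by
    apply Real.sqrt_le_iff.2; constructor <;> nlinarith
  have hs2 : r / 2 ≤ √(qF p w x) := by
    apply Real.le_sqrt_of_sq_le; nlinarith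
  have hr0 : 0 < r := by linarith
  have hE1 : 1 / (2 * r) ≤ eF p w x := by
    unfold eF; rw [← one_div]; exact one_div_le_one_div_of_le (by positivity) hs1
  have hE2 : eF p w x ≤ 2 / r := by
    unfold eF
    calc _ ≤ (r/2)⁻¹ := by gcongr
      _ = _ := by rw [inv_div]
  have hxn := znorm_nonneg x
  have hr3 : r ≤ 3 * R := by
    have := vnorm_sub_le (cv x) w
    rw [← znorm_eq, hw] at this
    linarith
  have habs : |znorm x - R| ≤ r := by
    have := vnorm_abs (cv x) w
    rwa [← znorm_eq, hw] at this
  refine ⟨⟨hd, plo, phi, psum, hR, ?_, hq, ?_, ?_, ?_, ?_⟩, hE1, hE2⟩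
  · rw [← vnorm_sq, hw]
  · refine hE2.trans ?_
    rw [div_le_iff₀ hr0]; linarith
  · have h1 : |phiF R x| ≤ r * (3 * R) := by
      rw [phiF_eq, show R^2 - znorm x^2 = - ((znorm x - R) * (R + znorm x)) by ring, abs_neg, abs_mul,
        abs_of_nonneg (by linarith : 0 ≤ R + znorm x)]
      gcongr; linarith
    have hE0 : 0 < eF p w x := lt_of_lt_of_le (by positivity) hE1
    calc _ ≤ (r * (3 * R)) * (2 / r) := by gcongr
      _ = _ := by field_simp; norm_num
  · intro i
    have := abs_le_znorm x i
    linarith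
  · calc 1 = 6 * R * (1 / (6 * R)) := by field_simp
      _ ≤ 6 * R * (1 / (2 * r)) := by
        refine mul_le_mul_of_nonneg_left ?_ (by positivity)
        exact one_div_le_one_div_of_le (by positivity) (by linarith)
      _ ≤ _ := by gcongr

theorem pole {d : ℕ} {L R : ℝ} (hL : 1 ≤ L) (h1 : L ≤ R) (h2 : R ≤ L + 1) {z : Fin d → ℤ}
    (hz : z ∈ outerBoundary d L) : ∃ w : Fin d → ℝ, vnorm w = R ∧ vnorm (cv z - w) ≤ 1 := by
  obtain ⟨hz1, i, hi⟩ := hz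
  have hz2 : znorm z ≤ L + 1 := by
    rcases hi with h | h
    · have := abs_le.1 (nbr_sub z i 0)
      simp only [sub_zero, ← znorm_eq] at this
      linarith
    · have := abs_le.1 (nbr_add z i 0)
      simp only [sub_zero, ← znorm_eq] at this
      linarith
  have hz0 : 0 < znorm z := by linarith
  refine ⟨(R / znorm z) • cv z, ?_, ?_⟩
  · rw [vnorm_smul, ← znorm_eq, abs_of_pos (by apply div_pos <;> linarith)]
    field_simp
  · have : cv z - (R / znorm z) • cv z = (1 - R / znorm z) • cv z := by rw [sub_smul, one_smul]
    rw [this, vnorm_smul, ← znorm_eq]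
    rw [show 1 - R / znorm z = (znorm z - R) / znorm z by field_simp, abs_div, abs_of_pos hz0,
      div_mul_cancel₀ _ hz0.ne', abs_le]
    constructor <;> linarith

theorem znorm_ge_one {d : ℕ} {x : Fin d → ℤ} (hx : x ≠ 0) : 1 ≤ znorm x := by
  obtain ⟨i, hi⟩ : ∃ i, x i ≠ 0 := by
    by_contra! h; exact hx (funext h)
  refine le_trans ?_ (abs_le_znorm x i)
  have := Int.one_le_abs hi
  exact_mod_cast this

/-- near the exit point the exit probability is bounded below -/
theorem near_lower {d : ℕ} (hd : 0 < d) (K : ℝ) (hK : 0 ≤ K) : ∃ c > (0:ℝ), c ≤ 1 ∧ ∀ (p : Fin d → ℝ) (L : ℝ) (x z : Fin d → ℤ),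
    (∀ i, 1 / (4 * (d:ℝ)) ≤ p i) → (∑ i, 2 * p i = 1) → znorm x ≤ L → z ∈ outerBoundary d L →
    znorm (x - z) ≤ K → c ≤ exitProb p L x z := by
  have hd' : (1:ℝ) ≤ d := by exact_mod_cast hd
  set q : ℝ := 1 / (4 * (d:ℝ)) with hq
  have hq0 : 0 < q := by positivity
  have hq1 : q ≤ 1 := by rw [hq, div_le_one (by positivity)]; linarith
  set n := ⌈d * (K+1)⌉₊ with hn
  refine ⟨q^n * q, by positivity, mul_le_one₀ (pow_le_one₀ hq0.le hq1) hq0.le hq1, fun p L x z plo psum hx hz hxz => ?_⟩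
  have hp : ∀ i, 0 ≤ p i := fun i => hq0.le.trans (plo i)
  obtain ⟨f0, f1, f2, f3⟩ := exitProb_spec hp psum L z
  have fz : exitProb p L z z = 1 := by rw [f2 z hz.1, if_pos rfl]
  obtain ⟨z', hz', hzz, hfz⟩ : ∃ z', znorm z' ≤ L ∧ znorm (z - z') ≤ 1 ∧ q ≤ exitProb p L z' z := by
    obtain ⟨i, hi⟩ := hz.2
    have hsingle : ∀ y, znorm y ≤ L → p i * (exitProb p L (y + unitVec i) z + exitProb p L (y - unitVec i) z) ≤ exitProb p L y z := by
      intro y hy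
      rw [f3 y hy]; unfold stepOp
      exact Finset.single_le_sum (f := fun i => p i * (exitProb p L (y + unitVec i) z + exitProb p L (y - unitVec i) z))
        (fun i _ => mul_nonneg (hp i) (add_nonneg (f0 _) (f0 _))) (Finset.mem_univ i)
    rcases hi with h | h
    · refine ⟨z - unitVec i, h, ?_, ?_⟩
      · rw [sub_sub_cancel, znorm_eq, vnorm_unit]
      · have := hsingle _ h
        rw [sub_add_cancel, fz] at this
        have a := f0 (z - unitVec i - unitVec i)
        have b := plo i
        nlinarith [mul_nonneg (hp i) a]
    · refine ⟨z + unitVec i, h, ?_, ?_⟩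
      · rw [znorm_eq, cv_sub, vnorm_comm, ← cv_sub, add_sub_cancel_left, vnorm_unit]
      · have := hsingle _ h
        rw [add_sub_cancel_right, fz] at this
        have a := f0 (z + unitVec i + unitVec i)
        have b := plo i
        nlinarith [mul_nonneg (hp i) a]
  have hxz' : znorm (x - z') ≤ K + 1 := by
    have := vnorm_tri (cv x) (cv z) (cv z')
    rw [← cv_sub, ← cv_sub, ← cv_sub, ← znorm_eq, ← znorm_eq, ← znorm_eq] at this
    linarith
  have hsum : ∑ i, (x i - z' i).natAbs ≤ n := by
    have h : ((∑ i, (x i - z' i).natAbs : ℕ) : ℝ) ≤ d * (K+1) := by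
      push_cast
      calc _ ≤ ∑ _i : Fin d, (K+1) := by
            refine Finset.sum_le_sum fun i _ => ?_
            have := (abs_le_znorm (x - z') i).trans hxz'
            rw [Pi.sub_apply] at this
            rw [Nat.cast_natAbs]
            push_cast at this ⊢
            exact this
        _ = _ := by simp; ring
    exact_mod_cast h.trans (Nat.le_ceil _)
  have := path_lemma hp hq0.le hq1 plo L (fun y => exitProb p L y z) f0 f3 n x z' hx hz' hsum
  refine le_trans ?_ this
  gcongr

theorem upperBd (d : ℕ) (hd3 : 3 ≤ d) : ∃ κ > (0:ℝ), ∃ C > (0:ℝ), ∀ (p : Fin d → ℝ) (L : ℝ) (x z : Fin d → ℤ), 1 ≤ L →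
    (∀ i, 1 / (4 * (d:ℝ)) ≤ p i) → (∀ i, p i ≤ 1 / d) → (∑ i, 2 * p i = 1) →
    (∀ i, |p i - 1 / (2 * (d:ℝ))| ≤ κ) → znorm x ≤ L → z ∈ outerBoundary d L →
    exitProb p L x z ≤ C * (max 1 (L - znorm x) / znorm (x - z)^d) := by
  obtain ⟨κ, hκ, e0, he0, W, hW⟩ := barrier d hd3
  have hd0 : 0 < d := by omega
  have hdR : (0:ℝ) < d := by exact_mod_cast hd0
  set K : ℝ := max 40 (2 / e0) with hK
  have hK40 : 40 ≤ K := le_max_left _ _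
  have hKe : 2 / e0 ≤ K := le_max_right _ _
  set C0 : ℝ := 2 * (2 * (K + 1))^d with hC0
  have hC0p : 0 < C0 := by positivity
  refine ⟨κ, hκ, max (6 * C0 * 4^d) ((K+2)^d), by positivity, fun p L x z hL plo phi psum hpκ hx hz => ?_⟩
  have hp : ∀ i, 0 < p i := fun i => lt_of_lt_of_le (by positivity) (plo i)
  obtain ⟨f0, f1, f2, f3⟩ := exitProb_spec (fun i => (hp i).le) psum L z
  have hzL := hz.1
  obtain ⟨w, hw, hzw⟩ := pole (R := L + 1) hL (by linarith) le_rfl hz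
  have hne : x ≠ z := by rintro rfl; linarith
  have hxz1 : 1 ≤ znorm (x - z) := znorm_ge_one (sub_ne_zero.2 hne)
  have htri : znorm (x - z) ≤ vnorm (cv x - w) + 1 := by
    have := vnorm_tri (cv x) w (cv z)
    rw [vnorm_comm w] at this
    rw [znorm_eq, cv_sub]; linarith
  have hmax1 : 1 ≤ max 1 (L - znorm x) := le_max_left _ _
  have hmax2 : L - znorm x ≤ max 1 (L - znorm x) := le_max_right _ _
  set mm := max 1 (L - znorm x)
  by_cases hfar : vnorm (cv x - w) < K + 1
  · have h1 : 1 ≤ (K+2)^d * (mm / znorm (x - z)^d) := by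
      rw [← mul_div_assoc, le_div_iff₀ (by positivity), one_mul]
      calc znorm (x - z)^d ≤ (K+2)^d := by gcongr; linarith
        _ ≤ _ := le_mul_of_one_le_right (by positivity) hmax1
    calc _ ≤ 1 := f1 x
      _ ≤ _ := h1
      _ ≤ _ := by gcongr; exact le_max_right _ _
  push Not at hfar
  set R := L + 1 with hR
  have hR1 : 1 ≤ R := by linarith
  have key : ∀ y, znorm y ≤ R → K ≤ vnorm (cv y - w) → 
      Geo p R w y ∧ 1 / (2 * vnorm (cv y - w)) ≤ eF p w y ∧ eF p w y ≤ 2 / vnorm (cv y - w) ∧ 0 ≤ phiF R y ∧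
      |W p R w y| ≤ 1/2 * (phiF R y * eF p w y ^ d) ∧
      |stepOp p (fun x => phiF R x * eF p w x ^ d) y - phiF R y * eF p w y ^ d| ≤ stepOp p (W p R w) y - W p R w y := by
    intro y hy hKy
    obtain ⟨g, g1, g2⟩ := geoLemma hd0 plo phi psum hR1 hw (by linarith : znorm y ≤ R + 1) (hK40.trans hKy)
    have hφ : 0 ≤ phiF R y := by
      rw [phiF_eq]; have := znorm_nonneg y; nlinarith
    have hr0 : 0 < vnorm (cv y - w) := by linarith
    have he : eF p w y ≤ e0 := by
      refine g2.trans ?_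
      rw [div_le_iff₀ hr0]
      have := hKe.trans hKy
      rw [div_le_iff₀ he0] at this
      linarith
    obtain ⟨b1, b2⟩ := hW p R w y g hpκ he
    rw [abs_of_nonneg hφ] at b1
    exact ⟨g, g1, g2, hφ, b1, b2 hφ⟩
  set D : Set (Fin d → ℤ) := {y | znorm y ≤ L ∧ K + 1 ≤ vnorm (cv y - w)} with hD
  set h : (Fin d → ℤ) → ℝ := fun y => phiF R y * eF p w y ^ d - W p R w y with hh
  have hmp := max_principle hd0 hp psum D ((ball_finite L).subset fun y hy => hy.1)
    (fun y => exitProb p L y z - C0 / R * h y) ?_ ?_ x ⟨hx, hfar⟩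
  · obtain ⟨g, g1, g2, hφ, b1, b2⟩ := key x (by linarith) (by linarith)
    have b1 := (abs_le.1 b1).1
    have hh2 : h x ≤ 3/2 * (phiF R x * eF p w x ^ d) := by simp only [hh]; linarith
    set r := vnorm (cv x - w)
    have hr0 : 0 < r := by linarith
    have hE := g.epos
    have hφ2 : phiF R x ≤ 2 * mm * (2 * R) := by
      rw [phiF_eq, show R^2 - znorm x^2 = (R - znorm x) * (R + znorm x) by ring]
      have := znorm_nonneg x
      have : 0 ≤ R - znorm x := by linarith
      gcongr <;> linarith
    have hE4 : eF p w x ≤ 4 / znorm (x - z) := by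
      refine g2.trans ?_
      rw [div_le_div_iff₀ hr0 (by linarith)]; linarith
    have hR0 : 0 < R := by linarith
    calc exitProb p L x z ≤ C0 / R * h x := by linarith
      _ ≤ C0 / R * (3/2 * (2 * mm * (2 * R) * (4 / znorm (x - z))^d)) := by
        gcongr
        refine hh2.trans ?_
        gcongr
      _ = 6 * C0 * 4^d * (mm / znorm (x - z)^d) := by rw [div_pow]; field_simp; ring
      _ ≤ _ := by gcongr; exact le_max_left _ _
  · intro y hy
    obtain ⟨g, g1, g2, hφ, b1, b2⟩ := key y (by linarith [hy.1]) (by linarith [hy.2])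
    rw [stepOp_sub, stepOp_mul, f3 y hy.1]
    have : stepOp p h y ≤ h y := by
      rw [hh, stepOp_sub]
      have := le_trans (le_abs_self _) b2
      linarith
    have : C0 / R * stepOp p h y ≤ C0 / R * h y := by gcongr
    linarith
  · have hout : ∀ y, y ∉ D → znorm y ≤ R → K ≤ vnorm (cv y - w) → exitProb p L y z - C0 / R * h y ≤ 0 := by
      intro y hyD hyR hyK
      obtain ⟨g, g1, g2, hφ, b1, b2⟩ := key y hyR hyK
      have b1 := (abs_le.1 b1).2
      have hE := g.epos
      have hh2 : 1/2 * (phiF R y * eF p w y ^ d) ≤ h y := by simp only [hh]; linarith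
      have hh0 : 0 ≤ h y := le_trans (by positivity) hh2
      by_cases hyL : znorm y ≤ L
      · have hr : vnorm (cv y - w) < K + 1 := by
          by_contra hc; exact hyD ⟨hyL, not_lt.1 hc⟩
        set r := vnorm (cv y - w)
        have hφR : R ≤ phiF R y := by
          rw [phiF_eq]
          have := znorm_nonneg y
          nlinarith
        have hE2 : 1 / (2 * (K+1)) ≤ eF p w y := by
          refine le_trans ?_ g1
          exact one_div_le_one_div_of_le (by linarith) (by linarith)
        have : 1 ≤ C0 / R * h y := by
          calc 1 = C0 / R * (1/2 * (R * (1 / (2 * (K+1)))^d)) := by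
                rw [hC0, div_pow, one_pow]; field_simp
            _ ≤ C0 / R * (1/2 * (phiF R y * eF p w y ^ d)) := by gcongr
            _ ≤ _ := by gcongr
        linarith [f1 y]
      · rw [f2 y (not_le.1 hyL), if_neg]
        · have : 0 ≤ C0 / R * h y := by positivity
          linarith
        · rintro rfl; linarith
    intro y hy i
    have a1 := abs_le.1 (nbr_add y i 0)
    have a2 := abs_le.1 (nbr_sub y i 0)
    simp only [sub_zero, ← znorm_eq] at a1 a2
    have a3 := abs_le.1 (nbr_add y i w)
    have a4 := abs_le.1 (nbr_sub y i w)
    have hy1 := hy.1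
    have hy2 := hy.2
    exact ⟨fun hn => hout _ hn (by linarith) (by linarith), fun hn => hout _ hn (by linarith) (by linarith)⟩

theorem lowerBd (d : ℕ) (hd3 : 3 ≤ d) : ∃ κ > (0:ℝ), ∃ C > (0:ℝ), ∀ (p : Fin d → ℝ) (L : ℝ) (x z : Fin d → ℤ), 1 ≤ L →
    (∀ i, 1 / (4 * (d:ℝ)) ≤ p i) → (∀ i, p i ≤ 1 / d) → (∑ i, 2 * p i = 1) →
    (∀ i, |p i - 1 / (2 * (d:ℝ))| ≤ κ) → znorm x ≤ L → z ∈ outerBoundary d L →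
    C * ((L - znorm x) / znorm (x - z)^d) ≤ exitProb p L x z := by
  obtain ⟨κ, hκ, e0, he0, W, hW⟩ := barrier d hd3
  have hd0 : 0 < d := by omega
  have hdR : (0:ℝ) < d := by exact_mod_cast hd0
  set K : ℝ := max 40 (2 / e0) with hK
  have hK40 : 40 ≤ K := le_max_left _ _
  have hKe : 2 / e0 ≤ K := le_max_right _ _
  obtain ⟨c, hc0, hc1, hc⟩ := near_lower hd0 (K + 2) (by linarith)
  set C0 : ℝ := c / (3 * (K + 1)) with hC0
  have hC0p : 0 < C0 := by positivity
  refine ⟨κ, hκ, C0 / 2 / 4^d, by positivity, fun p L x z hL plo phi psum hpκ hx hz => ?_⟩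
  have hp : ∀ i, 0 < p i := fun i => lt_of_lt_of_le (by positivity) (plo i)
  obtain ⟨f0, f1, f2, f3⟩ := exitProb_spec (fun i => (hp i).le) psum L z
  have hzL := hz.1
  obtain ⟨w, hw, hzw⟩ := pole (R := L) hL le_rfl (by linarith) hz
  have hne : x ≠ z := by rintro rfl; linarith
  have hxz1 : 1 ≤ znorm (x - z) := znorm_ge_one (sub_ne_zero.2 hne)
  have htri : ∀ y, znorm (y - z) ≤ vnorm (cv y - w) + 1 := by
    intro y
    have := vnorm_tri (cv y) w (cv z)
    rw [vnorm_comm w] at this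
    rw [znorm_eq, cv_sub]; linarith
  have htri2 : vnorm (cv x - w) ≤ znorm (x - z) + 1 := by
    have := vnorm_tri (cv x) (cv z) w
    rw [znorm_eq, cv_sub]; linarith
  have hdel : ∀ y, L - znorm y ≤ vnorm (cv y - w) := by
    intro y
    have := vnorm_abs (cv y) w
    rw [← znorm_eq, hw] at this
    linarith [(abs_le.1 this).1]
  have hδ : 0 ≤ L - znorm x := by linarith
  by_cases hfar : vnorm (cv x - w) < K + 1
  · have h0 : c ≤ exitProb p L x z := hc p L x z plo psum hx hz (by linarith [htri x])
    refine le_trans ?_ h0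
    have h4 : (1:ℝ) ≤ 4^d := one_le_pow₀ (by norm_num)
    have h5 : 1 ≤ znorm (x - z)^d := one_le_pow₀ hxz1
    calc C0 / 2 / 4^d * ((L - znorm x) / znorm (x - z)^d) ≤ C0 / 2 / 1 * ((K+1) / 1) := by
          gcongr; linarith [hdel x]
      _ ≤ C0 * (3 * (K+1)) := by nlinarith
      _ = c := by rw [hC0]; field_simp
  push Not at hfar
  have key : ∀ y, znorm y ≤ L + 1 → K ≤ vnorm (cv y - w) → 
      Geo p L w y ∧ 1 / (2 * vnorm (cv y - w)) ≤ eF p w y ∧ eF p w y ≤ 2 / vnorm (cv y - w) ∧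
      |W p L w y| ≤ 1/2 * (|phiF L y| * eF p w y ^ d) ∧
      (0 ≤ phiF L y → |stepOp p (fun x => phiF L x * eF p w x ^ d) y - phiF L y * eF p w y ^ d| ≤ stepOp p (W p L w) y - W p L w y) := by
    intro y hy hKy
    obtain ⟨g, g1, g2⟩ := geoLemma hd0 plo phi psum hL hw hy (hK40.trans hKy)
    have hr0 : 0 < vnorm (cv y - w) := by linarith
    have he : eF p w y ≤ e0 := by
      refine g2.trans ?_
      rw [div_le_iff₀ hr0]
      have := hKe.trans hKy
      rw [div_le_iff₀ he0] at this
      linarith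
    obtain ⟨b1, b2⟩ := hW p L w y g hpκ he
    exact ⟨g, g1, g2, b1, b2⟩
  have hφn : ∀ y : Fin d → ℤ, znorm y ≤ L → 0 ≤ phiF L y := by
    intro y hy
    rw [phiF_eq]; have := znorm_nonneg y; nlinarith
  set D : Set (Fin d → ℤ) := {y | znorm y ≤ L ∧ K + 1 ≤ vnorm (cv y - w)} with hD
  set h : (Fin d → ℤ) → ℝ := fun y => phiF L y * eF p w y ^ d + W p L w y with hh
  have hmp := max_principle hd0 hp psum D ((ball_finite L).subset fun y hy => hy.1)
    (fun y => C0 / L * h y - exitProb p L y z) ?_ ?_ x ⟨hx, hfar⟩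
  · obtain ⟨g, g1, g2, b1, b2⟩ := key x (by linarith) (by linarith)
    have hφ := hφn x hx
    rw [abs_of_nonneg hφ] at b1
    have b1 := (abs_le.1 b1).1
    have hh2 : 1/2 * (phiF L x * eF p w x ^ d) ≤ h x := by simp only [hh]; linarith
    set r := vnorm (cv x - w)
    have hr0 : 0 < r := by linarith
    have hE := g.epos
    have hφ2 : (L - znorm x) * L ≤ phiF L x := by
      rw [phiF_eq, show L^2 - znorm x^2 = (L - znorm x) * (L + znorm x) by ring]
      have := znorm_nonneg x
      gcongr; linarith
    have hE4 : 1 / (4 * znorm (x - z)) ≤ eF p w x := by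
      refine le_trans ?_ g1
      exact one_div_le_one_div_of_le (by linarith) (by linarith)
    have hL0 : 0 < L := by linarith
    calc C0 / 2 / 4^d * ((L - znorm x) / znorm (x - z)^d)
        = C0 / L * (1/2 * ((L - znorm x) * L * (1 / (4 * znorm (x - z)))^d)) := by
          rw [div_pow, one_pow, mul_pow]; field_simp
      _ ≤ C0 / L * (1/2 * (phiF L x * eF p w x ^ d)) := by gcongr
      _ ≤ C0 / L * h x := by gcongr
      _ ≤ _ := by linarith
  · intro y hy
    obtain ⟨g, g1, g2, b1, b2⟩ := key y (by linarith [hy.1]) (by linarith [hy.2])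
    rw [stepOp_sub, stepOp_mul, ← f3 y hy.1]
    have : h y ≤ stepOp p h y := by
      rw [hh, stepOp_add]
      have := le_trans (neg_abs_le _ |> neg_le.1) (b2 (hφn y hy.1))
      linarith
    have : C0 / L * h y ≤ C0 / L * stepOp p h y := by gcongr
    linarith
  · have hout : ∀ y, y ∉ D → znorm y ≤ L + 1 → K ≤ vnorm (cv y - w) → C0 / L * h y - exitProb p L y z ≤ 0 := by
      intro y hyD hyR hyK
      obtain ⟨g, g1, g2, b1, b2⟩ := key y hyR hyK
      have hE := g.epos
      by_cases hyL : znorm y ≤ L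
      · have hφ := hφn y hyL
        rw [abs_of_nonneg hφ] at b1
        have b1 := (abs_le.1 b1).2
        have hh2 : h y ≤ 3/2 * (phiF L y * eF p w y ^ d) := by simp only [hh]; linarith
        have hr : vnorm (cv y - w) < K + 1 := by
          by_contra hc; exact hyD ⟨hyL, not_lt.1 hc⟩
        have h0 : c ≤ exitProb p L y z := hc p L y z plo psum hyL hz (by linarith [htri y])
        have hdy := hdel y
        set r := vnorm (cv y - w)
        have hφR : phiF L y ≤ (K + 1) * (2 * L) := by
          rw [phiF_eq, show L^2 - znorm y^2 = (L - znorm y) * (L + znorm y) by ring]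
          have := znorm_nonneg y
          have : 0 ≤ L - znorm y := by linarith
          gcongr <;> linarith
        have hE2 : eF p w y ≤ 1 := by
          have := g.he; linarith
        have : C0 / L * h y ≤ c := by
          calc C0 / L * h y ≤ C0 / L * (3/2 * ((K + 1) * (2 * L) * 1 ^ d)) := by
                gcongr
                refine hh2.trans ?_
                gcongr
            _ = c := by rw [hC0, one_pow]; field_simp
        linarith
      · have hφ : phiF L y ≤ 0 := by
          rw [phiF_eq]; push Not at hyL; nlinarith
        rw [abs_of_nonpos hφ] at b1
        have b1 := (abs_le.1 b1).2
        have hP : 0 < eF p w y ^ d := by positivity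
        have hh2 : h y ≤ 0 := by
          simp only [hh]
          have : phiF L y * eF p w y ^ d ≤ 0 := mul_nonpos_of_nonpos_of_nonneg hφ hP.le
          nlinarith
        have : C0 / L * h y ≤ 0 := mul_nonpos_of_nonneg_of_nonpos (by positivity) hh2
        linarith [f0 y]
    intro y hy i
    have a1 := abs_le.1 (nbr_add y i 0)
    have a2 := abs_le.1 (nbr_sub y i 0)
    simp only [sub_zero, ← znorm_eq] at a1 a2
    have a3 := abs_le.1 (nbr_add y i w)
    have a4 := abs_le.1 (nbr_sub y i w)
    have hy1 := hy.1
    have hy2 := hy.2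
    exact ⟨fun hn => hout _ hn (by linarith) (by linarith), fun hn => hout _ hn (by linarith) (by linarith)⟩

/-- for `d ≥ 3` and symmetric nearest-neighbor kernels `p` close enough to
simple random walk, there is `C > 0` such that for large `L`, all `x ∈ V_L` and
`z ∈ ∂V_L`:
`C⁻¹ d_L(x)/|x-z|^d ≤ π_L^{(p)}(x,z) ≤ C max{1, d_L(x)}/|x-z|^d`, `d_L(x) = L - |x|`. -/
theorem stmt12 (d : ℕ) (hd : 3 ≤ d) :
    ∃ κ₀ > (0:ℝ), ∃ C > (0:ℝ), ∃ L₀ : ℝ, 1 ≤ L₀ ∧ ∀ L : ℝ, L₀ ≤ L →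
      ∀ p : Fin d → ℝ, (∀ i, 0 ≤ p i) → (∑ i, 2 * p i = 1) →
        (∀ i, |p i - 1/(2*(d:ℝ))| ≤ κ₀) →
        ∀ x : Fin d → ℤ, znorm x ≤ L →
          ∀ z ∈ outerBoundary d L,
            C⁻¹ * ((L - znorm x) / znorm (x - z)^d) ≤ exitProb p L x z ∧
            exitProb p L x z ≤ C * (max 1 (L - znorm x) / znorm (x - z)^d) := by
  obtain ⟨κ1, hκ1, C1, hC1, h1⟩ := upperBd d hd
  obtain ⟨κ2, hκ2, C2, hC2, h2⟩ := lowerBd d hd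
  have hd' : (0:ℝ) < d := by exact_mod_cast (by omega : 0 < d)
  refine ⟨min (min κ1 κ2) (1 / (4 * (d:ℝ))), by positivity, max C1 C2⁻¹, by positivity, 1, le_rfl,
    fun L hL p _ psum hpκ x hx z hz => ?_⟩
  have k1 : ∀ i, |p i - 1/(2*(d:ℝ))| ≤ κ1 := fun i => (hpκ i).trans ((min_le_left _ _).trans (min_le_left _ _))
  have k2 : ∀ i, |p i - 1/(2*(d:ℝ))| ≤ κ2 := fun i => (hpκ i).trans ((min_le_left _ _).trans (min_le_right _ _))
  have k3 : ∀ i, |p i - 1/(2*(d:ℝ))| ≤ 1 / (4 * (d:ℝ)) := fun i => (hpκ i).trans (min_le_right _ _)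
  have e1 : 1 / (2 * (d:ℝ)) = 1/2 * (1 / d) := by field_simp
  have e2 : 1 / (4 * (d:ℝ)) = 1/4 * (1 / d) := by field_simp
  have e3 : 0 < 1 / (d:ℝ) := by positivity
  have plo : ∀ i, 1 / (4 * (d:ℝ)) ≤ p i := fun i => by
    have := abs_le.1 (k3 i)
    rw [e1, e2] at this; rw [e2]; linarith
  have phi : ∀ i, p i ≤ 1 / d := fun i => by
    have := abs_le.1 (k3 i)
    rw [e1, e2] at this; linarith
  have hn := znorm_nonneg (x - z)
  constructor
  · refine le_trans ?_ (h2 p L x z hL plo phi psum k2 hx hz)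
    have hδ : 0 ≤ L - znorm x := by linarith
    have : (max C1 C2⁻¹)⁻¹ ≤ C2 := by
      rw [inv_le_comm₀ (by positivity) hC2]; exact le_max_right _ _
    gcongr
  · refine (h1 p L x z hL plo phi psum k1 hx hz).trans ?_
    have := le_max_left C1 C2⁻¹
    gcongr
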